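/- Let d ≥ 2, let 0 < r_1 < ... < r_N, and let F ∈ C^4 of the closed annulus {r_1 ≤ |x| ≤ r_N} in ℝ^d. Suppose I_4(F) is a biharmonic spline for the partition A(r_1,r_2),...,A(r_{N-1},r_N) (i.e. I_4(F) ∈ C^2 on the closed annulus, and on each open annulus A(r_j,r_{j+1}) it is C^4 with Δ^2 I_4(F) = 0) which satisfies the transfinite interpolation conditions I_4(F)(x) = F(x) for all x with |x| = r_j, j = 1,...,N, and the boundary conditions ∂I_4(F)/∂n (x) = ∂F/∂n (x) (equality of radial derivatives) for all x with |x| = r_1 and all x with |x| = r_N. Then ‖F - I_4(F)‖_{L^2(A(r_1,r_N))} ≤ C_d^2 · max_{j=1,...,N-1} (r_{j+1} - r_j)^4 · ‖Δ^2 F‖_{L^2(A(r_1,r_N))}, where C_d = max{1/(2d), 1/8}. -/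

import Mathlib

open MeasureTheory Metric Set Filter Topology

noncomputable section

/-- The Laplace operator `Δf = ∑ ∂²f/∂xᵢ²` on `ℝᵈ`. -/
def laplacian {d : ℕ} {V : Type*} [NormedAddCommGroup V] [NormedSpace ℝ V]
    (f : EuclideanSpace ℝ (Fin d) → V) (x : EuclideanSpace ℝ (Fin d)) : V :=
  ∑ i : Fin d, iteratedFDeriv ℝ 2 f x ![EuclideanSpace.single i 1, EuclideanSpace.single i 1]

/-- The open annulus `A(r,R) = {x ∈ ℝᵈ : r < |x| < R}`. -/
def annulus (d : ℕ) (r R : ℝ) : Set (EuclideanSpace ℝ (Fin d)) := {x | r < ‖x‖ ∧ ‖x‖ < R}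

/-- The closed annulus `{x ∈ ℝᵈ : r ≤ |x| ≤ R}`. -/
def closedAnnulus (d : ℕ) (r R : ℝ) : Set (EuclideanSpace ℝ (Fin d)) := {x | r ≤ ‖x‖ ∧ ‖x‖ ≤ R}

/-- A function is harmonic on an open set `U` if it is `C²` there and `Δf = 0` on `U`. -/
def HarmonicOn {d : ℕ} (f : EuclideanSpace ℝ (Fin d) → ℝ)
    (U : Set (EuclideanSpace ℝ (Fin d))) : Prop :=
  ContDiffOn ℝ 2 f U ∧ ∀ x ∈ U, laplacian f x = 0

/-- A harmonic spline for the partition `A(r 0, r 1), ..., A(r (n-1), r n)`: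
continuous on the closed annulus and harmonic on each open subannulus. -/
def HarmonicSpline (d n : ℕ) (r : Fin (n + 1) → ℝ)
    (S : EuclideanSpace ℝ (Fin d) → ℝ) : Prop :=
  ContinuousOn S (closedAnnulus d (r 0) (r (Fin.last n))) ∧
  ∀ i : Fin n, HarmonicOn S (annulus d (r i.castSucc) (r i.succ))

/-- A function is biharmonic on an open set `U` if it is `C⁴` there and `Δ²f = 0` on `U`. -/
def BiharmonicOn {d : ℕ} (f : EuclideanSpace ℝ (Fin d) → ℝ)
    (U : Set (EuclideanSpace ℝ (Fin d))) : Prop :=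
  ContDiffOn ℝ 4 f U ∧ ∀ x ∈ U, laplacian (laplacian f) x = 0

/-- A biharmonic spline for the partition `A(r 0, r 1), ..., A(r (n-1), r n)`:
`C²` on the closed annulus and biharmonic on each open subannulus. -/
def BiharmonicSpline (d n : ℕ) (r : Fin (n + 1) → ℝ)
    (S : EuclideanSpace ℝ (Fin d) → ℝ) : Prop :=
  ContDiffOn ℝ 2 S (closedAnnulus d (r 0) (r (Fin.last n))) ∧
  ∀ i : Fin n, BiharmonicOn S (annulus d (r i.castSucc) (r i.succ))

lemma isOpen_annulus (d : ℕ) (r R : ℝ) : IsOpen (annulus d r R) :=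
  (isOpen_lt continuous_const continuous_norm).inter (isOpen_lt continuous_norm continuous_const)

lemma isCompact_closedAnnulus (d : ℕ) (r R : ℝ) : IsCompact (closedAnnulus d r R) := by
  have h : closedAnnulus d r R = closedBall 0 R ∩ {x | r ≤ ‖x‖} := by
    ext x; simp [closedAnnulus, and_comm]
  rw [h]
  exact (isCompact_closedBall _ _).inter_right (isClosed_le continuous_const continuous_norm)

lemma integral_fderiv_eq_zero_of_compact {d : ℕ} {Ω K : Set (EuclideanSpace ℝ (Fin d))}
    (hΩ : IsOpen Ω) (hK : IsCompact K) (hKΩ : K ⊆ Ω) {f : EuclideanSpace ℝ (Fin d) → ℝ}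
    (hf : ContDiffOn ℝ 1 f Ω) (h0 : ∀ x ∉ K, f x = 0) (v : EuclideanSpace ℝ (Fin d)) :
    IntegrableOn (fun x ↦ fderiv ℝ f x v) Ω ∧ ∫ x in Ω, fderiv ℝ f x v = 0 := by
  have hts : tsupport f ⊆ K := closure_minimal (fun x hx ↦ by
    by_contra h; exact hx (h0 x h)) hK.isClosed
  have hcd : ContDiff ℝ 1 f := by
    refine contDiff_iff_contDiffAt.2 fun x ↦ ?_
    by_cases hx : x ∈ K
    · exact hf.contDiffAt (hΩ.mem_nhds (hKΩ hx))
    · refine (contDiffAt_const (c := (0 : ℝ))).congr_of_eventuallyEq ?_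
      filter_upwards [hK.isClosed.isOpen_compl.mem_nhds hx] with y hy using h0 y hy
  have hcs : HasCompactSupport f := HasCompactSupport.intro hK h0
  have hc : Continuous (fun x ↦ fderiv ℝ f x v) :=
    (hcd.continuous_fderiv one_ne_zero).clm_apply continuous_const
  have hcs' : HasCompactSupport (fun x ↦ fderiv ℝ f x v) := hcs.fderiv_apply ℝ v
  have hi : Integrable (fun x ↦ fderiv ℝ f x v) := hc.integrable_of_hasCompactSupport hcs'
  refine ⟨hi.integrableOn, ?_⟩
  rw [setIntegral_eq_integral_of_forall_compl_eq_zero]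
  · have := integral_mul_fderiv_eq_neg_fderiv_mul_of_integrable (μ := volume)
      (f := fun _ : EuclideanSpace ℝ (Fin d) ↦ (1 : ℝ)) (g := f) (v := v)
      (by simp) (by simpa using hi)
      (by simpa using hcd.continuous.integrable_of_hasCompactSupport hcs)
      (fun x _ ↦ by fun_prop) (fun x _ ↦ hcd.differentiable one_ne_zero x)
    simpa using this
  · intro x hx
    have : fderiv ℝ f x = 0 := by
      by_contra h
      exact hx (hKΩ (hts (support_fderiv_subset ℝ h)))
    simp [this]

/-- Divergence theorem for vector fields vanishing outside a compact subset of an open set. -/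
lemma integral_divergence_eq_zero {d : ℕ} {Ω K : Set (EuclideanSpace ℝ (Fin d))}
    (hΩ : IsOpen Ω) (hK : IsCompact K) (hKΩ : K ⊆ Ω)
    {X : Fin d → EuclideanSpace ℝ (Fin d) → ℝ} {g : EuclideanSpace ℝ (Fin d) → ℝ}
    (hX : ∀ i, ContDiffOn ℝ 1 (X i) Ω) (h0 : ∀ i, ∀ x ∉ K, X i x = 0)
    (hg : ∀ x ∈ Ω, ∑ i, fderiv ℝ (X i) x (EuclideanSpace.single i 1) = g x) :
    IntegrableOn g Ω ∧ ∫ x in Ω, g x = 0 := by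
  have h := fun i ↦ integral_fderiv_eq_zero_of_compact hΩ hK hKΩ (hX i) (h0 i)
    (EuclideanSpace.single i 1)
  refine ⟨?_, ?_⟩
  · refine IntegrableOn.congr_fun ?_ hg hΩ.measurableSet
    exact integrable_finsetSum _ fun i _ ↦ (h i).1
  · rw [← setIntegral_congr_fun hΩ.measurableSet hg, integral_finsetSum _ fun i _ ↦ (h i).1]
    exact Finset.sum_eq_zero fun i _ ↦ (h i).2

lemma laplacian_eq_sum_fderiv {d : ℕ} {f : EuclideanSpace ℝ (Fin d) → ℝ}
    {x : EuclideanSpace ℝ (Fin d)} (hf : ContDiffAt ℝ 2 f x) :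
    laplacian f x = ∑ i, fderiv ℝ (fun y ↦ fderiv ℝ f y (EuclideanSpace.single i 1)) x
      (EuclideanSpace.single i 1) := by
  have hd : DifferentiableAt ℝ (fderiv ℝ f) x :=
    (hf.fderiv_right (m := 1) (by norm_num)).differentiableAt one_ne_zero
  refine Finset.sum_congr rfl fun i _ ↦ ?_
  rw [iteratedFDeriv_two_apply]
  have := (hd.hasFDerivAt.clm_apply (hasFDerivAt_const (EuclideanSpace.single i (1 : ℝ)) x)).fderiv
  rw [this]
  simp

lemma hasFDerivAt_comp_norm {d : ℕ} {ψ : ℝ → ℝ} {ψ' : ℝ} {x : EuclideanSpace ℝ (Fin d)}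
    (hx : x ≠ 0) (h : HasDerivAt ψ ψ' ‖x‖) :
    HasFDerivAt (fun y : EuclideanSpace ℝ (Fin d) ↦ ψ ‖y‖)
      ((ψ' / ‖x‖) • innerSL ℝ x) x := by
  have h1 : HasFDerivAt (fun y : EuclideanSpace ℝ (Fin d) ↦ ‖y‖) (‖x‖⁻¹ • innerSL ℝ x) x := by
    have h2 := ((hasStrictFDerivAt_norm_sq x).hasFDerivAt.sqrt (by simpa using hx))
    simp only [Real.sqrt_sq (norm_nonneg _)] at h2
    have h3 : (1 / (2 * ‖x‖)) • 2 • innerSL ℝ x = ‖x‖⁻¹ • innerSL ℝ x := by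
      ext y
      have : ‖x‖ ≠ 0 := by simpa using hx
      simp
      field_simp
    rwa [h3] at h2
  have h4 := h.comp_hasFDerivAt x h1
  rwa [smul_smul, ← div_eq_mul_inv] at h4

lemma hasFDerivAt_coord {d : ℕ} (i : Fin d) (x : EuclideanSpace ℝ (Fin d)) :
    HasFDerivAt (fun y : EuclideanSpace ℝ (Fin d) ↦ y i)
      (EuclideanSpace.proj i : EuclideanSpace ℝ (Fin d) →L[ℝ] ℝ) x :=
  (EuclideanSpace.proj i : EuclideanSpace ℝ (Fin d) →L[ℝ] ℝ).hasFDerivAt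

lemma fderiv_apply_self_eq_sum {d : ℕ} (L : EuclideanSpace ℝ (Fin d) →L[ℝ] ℝ)
    (x : EuclideanSpace ℝ (Fin d)) : L x = ∑ i, x i * L (EuclideanSpace.single i 1) := by
  have hx : x = ∑ i, x i • EuclideanSpace.single i (1 : ℝ) := by
    ext j; simp [Finset.sum_apply, Pi.single_apply]
  conv_lhs => rw [hx]
  simp

lemma sum_sq_eq_norm_sq {d : ℕ} (x : EuclideanSpace ℝ (Fin d)) : ∑ i, x i * x i = ‖x‖ ^ 2 := by
  rw [EuclideanSpace.norm_sq_eq]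
  exact Finset.sum_congr rfl fun i _ ↦ by rw [Real.norm_eq_abs, sq_abs, sq]

lemma contDiffOn_comp_norm {d : ℕ} {r R : ℝ} (hr : 0 < r) {m : WithTop ℕ∞} {ψ : ℝ → ℝ}
    (hψ : ContDiffOn ℝ m ψ (Ioo r R)) :
    ContDiffOn ℝ m (fun x : EuclideanSpace ℝ (Fin d) ↦ ψ ‖x‖) (annulus d r R) :=
  hψ.comp (contDiffOn_id.norm ℝ fun x hx ↦ by
    have : 0 < ‖x‖ := hr.trans hx.1
    simpa using this) fun x hx ↦ hx

lemma contDiffOn_coord {d : ℕ} {m : WithTop ℕ∞} (i : Fin d) (Ω : Set (EuclideanSpace ℝ (Fin d))) :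
    ContDiffOn ℝ m (fun x : EuclideanSpace ℝ (Fin d) ↦ x i) Ω :=
  (EuclideanSpace.proj i : EuclideanSpace ℝ (Fin d) →L[ℝ] ℝ).contDiff.contDiffOn

lemma contDiffOn_partial {d : ℕ} {Ω : Set (EuclideanSpace ℝ (Fin d))} (hΩ : IsOpen Ω)
    {f : EuclideanSpace ℝ (Fin d) → ℝ} (hf : ContDiffOn ℝ 2 f Ω) (v : EuclideanSpace ℝ (Fin d)) :
    ContDiffOn ℝ 1 (fun x ↦ fderiv ℝ f x v) Ω :=
  (hf.fderiv_of_isOpen hΩ (by norm_num)).clm_apply contDiffOn_const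

lemma hasFDerivAt_of_contDiffOn {d : ℕ} {Ω : Set (EuclideanSpace ℝ (Fin d))} (hΩ : IsOpen Ω)
    {f : EuclideanSpace ℝ (Fin d) → ℝ} {m : WithTop ℕ∞} (hm : m ≠ 0) (hf : ContDiffOn ℝ m f Ω)
    {x : EuclideanSpace ℝ (Fin d)} (hx : x ∈ Ω) : HasFDerivAt f (fderiv ℝ f x) x :=
  ((hf.contDiffAt (hΩ.mem_nhds hx)).differentiableAt hm).hasFDerivAt

/-- The integrated form of a Picone type identity on an annulus, localised by a radial cutoff `φ`,
with radial logarithmic gradient `x ↦ κ ‖x‖ x`. -/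
lemma integral_picone_eq_zero {d : ℕ} {r R a b : ℝ} (hr : 0 < r) (ha : r < a) (hb : b < R)
    {φ φ' κ κ' : ℝ → ℝ} (hφ : ContDiff ℝ 1 φ) (hφ' : ∀ t, HasDerivAt φ (φ' t) t)
    (hφ0 : ∀ t, t ∉ Icc a b → φ t = 0)
    (hκ : ContDiffOn ℝ 1 κ (Ioo r R)) (hκ' : ∀ t ∈ Ioo r R, HasDerivAt κ (κ' t) t)
    {E : EuclideanSpace ℝ (Fin d) → ℝ} (hE : ContDiffOn ℝ 2 E (annulus d r R)) :
    let g := fun x : EuclideanSpace ℝ (Fin d) ↦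
      φ' ‖x‖ * (E x ^ 2 * κ ‖x‖ * ‖x‖ - E x * (fderiv ℝ E x x / ‖x‖)) +
      φ ‖x‖ * (2 * E x * κ ‖x‖ * fderiv ℝ E x x + E x ^ 2 * (κ' ‖x‖ * ‖x‖ + d * κ ‖x‖)
        - ∑ i, fderiv ℝ E x (EuclideanSpace.single i 1) * fderiv ℝ E x (EuclideanSpace.single i 1)
        - E x * laplacian E x)
    IntegrableOn g (annulus d r R) ∧ ∫ x in annulus d r R, g x = 0 := by
  intro g
  have hΩ := isOpen_annulus d r R
  refine integral_divergence_eq_zero hΩ (isCompact_closedAnnulus d a b)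
    (fun x hx ↦ ⟨ha.trans_le hx.1, hx.2.trans_lt hb⟩)
    (X := fun i x ↦ φ ‖x‖ * (E x ^ 2 * (κ ‖x‖ * x i) -
      E x * fderiv ℝ E x (EuclideanSpace.single i 1))) ?_ ?_ ?_
  · intro i
    have hE1 : ContDiffOn ℝ 1 E (annulus d r R) := hE.of_le (by norm_num)
    exact (contDiffOn_comp_norm hr hφ.contDiffOn).mul
      (((hE1.pow 2).mul ((contDiffOn_comp_norm hr hκ).mul (contDiffOn_coord i _))).sub
        (hE1.mul (contDiffOn_partial hΩ hE _)))
  · intro i x hx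
    have : φ ‖x‖ = 0 := hφ0 _ hx
    simp [this]
  · intro x hx
    have hx0 : 0 < ‖x‖ := hr.trans hx.1
    have hxne : x ≠ 0 := norm_pos_iff.1 hx0
    have hE1 := hasFDerivAt_of_contDiffOn hΩ two_ne_zero hE hx
    have key : ∀ i, fderiv ℝ (fun x ↦ φ ‖x‖ * (E x ^ 2 * (κ ‖x‖ * x i) -
        E x * fderiv ℝ E x (EuclideanSpace.single i 1))) x (EuclideanSpace.single i 1) =
        (φ' ‖x‖ / ‖x‖ * E x ^ 2 * κ ‖x‖ + φ ‖x‖ * E x ^ 2 * κ' ‖x‖ / ‖x‖) * (x i * x i) +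
        (2 * φ ‖x‖ * E x * κ ‖x‖ - φ' ‖x‖ / ‖x‖ * E x) *
          (x i * fderiv ℝ E x (EuclideanSpace.single i 1)) -
        φ ‖x‖ * (fderiv ℝ E x (EuclideanSpace.single i 1) *
          fderiv ℝ E x (EuclideanSpace.single i 1)) -
        φ ‖x‖ * E x * fderiv ℝ (fun y ↦ fderiv ℝ E y (EuclideanSpace.single i 1)) x
          (EuclideanSpace.single i 1) + φ ‖x‖ * E x ^ 2 * κ ‖x‖ := by
      intro i
      have hEi := hasFDerivAt_of_contDiffOn hΩ one_ne_zero
        (contDiffOn_partial hΩ hE (EuclideanSpace.single i 1)) hx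
      have h := ((hasFDerivAt_comp_norm hxne (hφ' ‖x‖)).mul
        (((hE1.pow 2).mul ((hasFDerivAt_comp_norm hxne (hκ' ‖x‖ hx)).mul
          (hasFDerivAt_coord i x))).sub (hE1.mul hEi))).fderiv
      erw [h]
      simp [EuclideanSpace.inner_single_right]
      ring
    rw [Finset.sum_congr rfl fun i _ ↦ key i]
    simp only [Finset.sum_add_distrib, Finset.sum_sub_distrib, ← Finset.mul_sum,
      Finset.sum_const, Finset.card_univ, Fintype.card_fin, nsmul_eq_mul]
    rw [← fderiv_apply_self_eq_sum, sum_sq_eq_norm_sq,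
      ← laplacian_eq_sum_fderiv (hE.contDiffAt (hΩ.mem_nhds hx))]
    simp only [g]
    field_simp
    ring

/-- Green's second identity on an annulus, localised by a radial cutoff `φ`, in a form in which no
derivative of `U` of first order appears. -/
lemma integral_green_eq_zero {d : ℕ} {r R a b : ℝ} (hr : 0 < r) (ha : r < a) (hb : b < R)
    {φ φ' φ'' : ℝ → ℝ} (hφ : ContDiff ℝ 1 φ) (hφ' : ∀ t, HasDerivAt φ (φ' t) t)
    (hφ1 : ContDiff ℝ 1 φ') (hφ'' : ∀ t, HasDerivAt φ' (φ'' t) t)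
    (hφ0 : ∀ t, t ∉ Icc a b → φ t = 0) (hφ0' : ∀ t, t ∉ Icc a b → φ' t = 0)
    {E U : EuclideanSpace ℝ (Fin d) → ℝ} (hE : ContDiffOn ℝ 2 E (annulus d r R))
    (hU : ContDiffOn ℝ 2 U (annulus d r R)) :
    let g := fun x : EuclideanSpace ℝ (Fin d) ↦
      φ ‖x‖ * (U x * laplacian E x - E x * laplacian U x) +
      (2 * φ' ‖x‖ * (U x * (fderiv ℝ E x x / ‖x‖)) +
        E x * U x * (φ'' ‖x‖ + (d - 1) / ‖x‖ * φ' ‖x‖))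
    IntegrableOn g (annulus d r R) ∧ ∫ x in annulus d r R, g x = 0 := by
  intro g
  have hΩ := isOpen_annulus d r R
  have hinv : ContDiffOn ℝ 1 (fun t : ℝ ↦ φ' t / t) (Ioo r R) :=
    hφ1.contDiffOn.div contDiffOn_id fun t ht ↦ (hr.trans ht.1).ne'
  refine integral_divergence_eq_zero hΩ (isCompact_closedAnnulus d a b)
    (fun x hx ↦ ⟨ha.trans_le hx.1, hx.2.trans_lt hb⟩)
    (X := fun i x ↦ φ ‖x‖ * (U x * fderiv ℝ E x (EuclideanSpace.single i 1) -
      E x * fderiv ℝ U x (EuclideanSpace.single i 1)) +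
      (φ' ‖x‖ / ‖x‖) * ((E x * U x) * x i)) ?_ ?_ ?_
  · intro i
    have hE1 : ContDiffOn ℝ 1 E (annulus d r R) := hE.of_le (by norm_num)
    have hU1 : ContDiffOn ℝ 1 U (annulus d r R) := hU.of_le (by norm_num)
    exact ((contDiffOn_comp_norm hr hφ.contDiffOn).mul
      ((hU1.mul (contDiffOn_partial hΩ hE _)).sub (hE1.mul (contDiffOn_partial hΩ hU _)))).add
      ((contDiffOn_comp_norm hr hinv).mul ((hE1.mul hU1).mul (contDiffOn_coord i _)))
  · intro i x hx
    have h1 : φ ‖x‖ = 0 := hφ0 _ hx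
    have h2 : φ' ‖x‖ = 0 := hφ0' _ hx
    simp [h1, h2]
  · intro x hx
    have hx0 : 0 < ‖x‖ := hr.trans hx.1
    have hxne : x ≠ 0 := norm_pos_iff.1 hx0
    have hE1 := hasFDerivAt_of_contDiffOn hΩ two_ne_zero hE hx
    have hU1 := hasFDerivAt_of_contDiffOn hΩ two_ne_zero hU hx
    have hχ : HasDerivAt (fun t ↦ φ' t / t)
        ((φ'' ‖x‖ * ‖x‖ - φ' ‖x‖ * 1) / ‖x‖ ^ 2) ‖x‖ :=
      (hφ'' ‖x‖).div (hasDerivAt_id _) hx0.ne'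
    have key : ∀ i, fderiv ℝ (fun x ↦ φ ‖x‖ * (U x * fderiv ℝ E x (EuclideanSpace.single i 1) -
        E x * fderiv ℝ U x (EuclideanSpace.single i 1)) +
        (φ' ‖x‖ / ‖x‖) * ((E x * U x) * x i)) x (EuclideanSpace.single i 1) =
        ((φ'' ‖x‖ * ‖x‖ - φ' ‖x‖ * 1) / ‖x‖ ^ 2 / ‖x‖ * (E x * U x)) * (x i * x i) +
        (2 * φ' ‖x‖ / ‖x‖ * U x) * (x i * fderiv ℝ E x (EuclideanSpace.single i 1)) +
        φ ‖x‖ * U x * fderiv ℝ (fun y ↦ fderiv ℝ E y (EuclideanSpace.single i 1)) x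
          (EuclideanSpace.single i 1) -
        φ ‖x‖ * E x * fderiv ℝ (fun y ↦ fderiv ℝ U y (EuclideanSpace.single i 1)) x
          (EuclideanSpace.single i 1) +
        φ' ‖x‖ / ‖x‖ * (E x * U x) := by
      intro i
      have hEi := hasFDerivAt_of_contDiffOn hΩ one_ne_zero
        (contDiffOn_partial hΩ hE (EuclideanSpace.single i 1)) hx
      have hUi := hasFDerivAt_of_contDiffOn hΩ one_ne_zero
        (contDiffOn_partial hΩ hU (EuclideanSpace.single i 1)) hx
      have h := (((hasFDerivAt_comp_norm hxne (hφ' ‖x‖)).mul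
        ((hU1.mul hEi).sub (hE1.mul hUi))).add
        ((hasFDerivAt_comp_norm hxne hχ).mul ((hE1.mul hU1).mul
          (hasFDerivAt_coord i x)))).fderiv
      erw [h]
      simp [EuclideanSpace.inner_single_right]
      ring
    rw [Finset.sum_congr rfl fun i _ ↦ key i]
    simp only [Finset.sum_add_distrib, Finset.sum_sub_distrib, ← Finset.mul_sum,
      Finset.sum_const, Finset.card_univ, Fintype.card_fin, nsmul_eq_mul]
    rw [← fderiv_apply_self_eq_sum, sum_sq_eq_norm_sq,
      ← laplacian_eq_sum_fderiv (hE.contDiffAt (hΩ.mem_nhds hx)),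
      ← laplacian_eq_sum_fderiv (hU.contDiffAt (hΩ.mem_nhds hx))]
    simp only [g]
    field_simp
    ring

/-- A smooth step which vanishes on `(-∞, 1]` and equals `1` on `[2, ∞)`. -/
def ramp (s : ℝ) : ℝ := Real.smoothTransition (s - 1)

lemma contDiff_ramp {n : ℕ∞} : ContDiff ℝ n ramp :=
  Real.smoothTransition.contDiff.comp (contDiff_id.sub contDiff_const)

lemma ramp_of_le_one {s : ℝ} (h : s ≤ 1) : ramp s = 0 :=
  Real.smoothTransition.zero_of_nonpos (by linarith)

lemma ramp_of_two_le {s : ℝ} (h : 2 ≤ s) : ramp s = 1 :=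
  Real.smoothTransition.one_of_one_le (by linarith)

lemma contDiff_deriv_ramp : ContDiff ℝ 1 (deriv ramp) :=
  ((contDiff_succ_iff_deriv (n := 1)).1 (contDiff_ramp (n := 2))).2.2

lemma continuous_deriv_deriv_ramp : Continuous (deriv (deriv ramp)) :=
  contDiff_deriv_ramp.continuous_deriv le_rfl

lemma hasDerivAt_ramp (s : ℝ) : HasDerivAt ramp (deriv ramp s) s :=
  ((contDiff_ramp (n := 1)).differentiable one_ne_zero s).hasDerivAt

lemma hasDerivAt_deriv_ramp (s : ℝ) : HasDerivAt (deriv ramp) (deriv (deriv ramp) s) s :=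
  (contDiff_deriv_ramp.differentiable one_ne_zero s).hasDerivAt

lemma deriv_eq_zero_of_eq_const {f : ℝ → ℝ} (hf : Continuous (deriv f)) {c : ℝ} {s : ℝ} :
    ((∀ t < s, f t = c) → deriv f s = 0) ∧ ((∀ t > s, f t = c) → deriv f s = 0) := by
  constructor
  · intro h
    have hz : ∀ t ∈ Iio s, deriv f t = 0 := fun t ht ↦ by
      have : f =ᶠ[𝓝 t] fun _ ↦ c := by
        filter_upwards [Iio_mem_nhds ht] with y hy using h y hy
      rw [this.deriv_eq]; simp
    have hs : s ∈ closure (Iio s) := by simp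
    exact (isClosed_eq hf continuous_const).closure_subset_iff.2 hz hs
  · intro h
    have hz : ∀ t ∈ Ioi s, deriv f t = 0 := fun t ht ↦ by
      have : f =ᶠ[𝓝 t] fun _ ↦ c := by
        filter_upwards [Ioi_mem_nhds ht] with y hy using h y hy
      rw [this.deriv_eq]; simp
    have hs : s ∈ closure (Ioi s) := by simp
    exact (isClosed_eq hf continuous_const).closure_subset_iff.2 hz hs

lemma deriv_ramp_eq_zero {s : ℝ} (h : s ∉ Ioo (1 : ℝ) 2) : deriv ramp s = 0 := by
  rcases le_or_gt s 1 with h1 | h1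
  · exact (deriv_eq_zero_of_eq_const contDiff_deriv_ramp.continuous (c := 0)).1
      fun t ht ↦ ramp_of_le_one (by linarith)
  · have h2 : 2 ≤ s := by
      by_contra h2
      exact h ⟨h1, not_le.1 h2⟩
    exact (deriv_eq_zero_of_eq_const contDiff_deriv_ramp.continuous (c := 1)).2
      fun t ht ↦ ramp_of_two_le (by linarith)

lemma deriv_deriv_ramp_eq_zero {s : ℝ} (h : s ∉ Ioo (1 : ℝ) 2) : deriv (deriv ramp) s = 0 := by
  rcases le_or_gt s 1 with h1 | h1
  · exact (deriv_eq_zero_of_eq_const continuous_deriv_deriv_ramp (c := 0)).1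
      fun t ht ↦ deriv_ramp_eq_zero fun h' ↦ by linarith [h'.1]
  · have h2 : 2 ≤ s := by
      by_contra h2
      exact h ⟨h1, not_le.1 h2⟩
    exact (deriv_eq_zero_of_eq_const continuous_deriv_deriv_ramp (c := 0)).2
      fun t ht ↦ deriv_ramp_eq_zero fun h' ↦ by linarith [h'.2]

lemma exists_bound_ramp :
    ∃ B : ℝ, 0 < B ∧ ∀ s, |deriv ramp s| ≤ B ∧ |deriv (deriv ramp) s| ≤ B := by
  obtain ⟨B₁, h₁⟩ := (isCompact_Icc (a := (1 : ℝ)) (b := 2)).exists_bound_of_continuousOn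
    contDiff_deriv_ramp.continuous.continuousOn
  obtain ⟨B₂, h₂⟩ := (isCompact_Icc (a := (1 : ℝ)) (b := 2)).exists_bound_of_continuousOn
    continuous_deriv_deriv_ramp.continuousOn
  refine ⟨max 1 (max B₁ B₂), by positivity, fun s ↦ ?_⟩
  by_cases hs : s ∈ Ioo (1 : ℝ) 2
  · have hs' : s ∈ Icc (1 : ℝ) 2 := Ioo_subset_Icc_self hs
    exact ⟨(h₁ s hs').trans (by simp), (h₂ s hs').trans (by simp)⟩
  · rw [deriv_ramp_eq_zero hs, deriv_deriv_ramp_eq_zero hs]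
    simp

/-- A smooth cutoff on the interval `(r, R)` with transition layers of width `ε`. -/
def cutoff (r R ε t : ℝ) : ℝ := ramp ((t - r) / ε) + ramp ((R - t) / ε) - 1

/-- The derivative of `cutoff r R ε`. -/
def cutoffDeriv (r R ε t : ℝ) : ℝ := (deriv ramp ((t - r) / ε) - deriv ramp ((R - t) / ε)) / ε

/-- The second derivative of `cutoff r R ε`. -/
def cutoffDerivTwo (r R ε t : ℝ) : ℝ :=
  (deriv (deriv ramp) ((t - r) / ε) + deriv (deriv ramp) ((R - t) / ε)) / ε ^ 2

lemma contDiff_cutoff (r R ε : ℝ) : ContDiff ℝ 1 (cutoff r R ε) :=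
  ((contDiff_ramp.comp ((contDiff_id.sub contDiff_const).div_const ε)).add
    (contDiff_ramp.comp ((contDiff_const.sub contDiff_id).div_const ε))).sub contDiff_const

lemma contDiff_cutoffDeriv (r R ε : ℝ) : ContDiff ℝ 1 (cutoffDeriv r R ε) :=
  ((contDiff_deriv_ramp.comp ((contDiff_id.sub contDiff_const).div_const ε)).sub
    (contDiff_deriv_ramp.comp ((contDiff_const.sub contDiff_id).div_const ε))).div_const ε

lemma hasDerivAt_cutoff (r R ε t : ℝ) : HasDerivAt (cutoff r R ε) (cutoffDeriv r R ε t) t := by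
  have h1 : HasDerivAt (fun t ↦ (t - r) / ε) (1 / ε) t :=
    ((hasDerivAt_id t).sub_const r).div_const ε
  have h2 : HasDerivAt (fun t ↦ (R - t) / ε) (-1 / ε) t :=
    ((hasDerivAt_id t).const_sub R).div_const ε
  refine ((((hasDerivAt_ramp _).comp t h1).add
    ((hasDerivAt_ramp _).comp t h2)).sub_const 1).congr_deriv ?_
  rw [cutoffDeriv]
  ring

lemma hasDerivAt_cutoffDeriv (r R ε t : ℝ) :
    HasDerivAt (cutoffDeriv r R ε) (cutoffDerivTwo r R ε t) t := by
  have h1 : HasDerivAt (fun t ↦ (t - r) / ε) (1 / ε) t :=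
    ((hasDerivAt_id t).sub_const r).div_const ε
  have h2 : HasDerivAt (fun t ↦ (R - t) / ε) (-1 / ε) t :=
    ((hasDerivAt_id t).const_sub R).div_const ε
  refine ((((hasDerivAt_deriv_ramp _).comp t h1).sub
    ((hasDerivAt_deriv_ramp _).comp t h2)).div_const ε).congr_deriv ?_
  rw [cutoffDerivTwo]
  ring

lemma cutoff_eq_zero {r R ε t : ℝ} (hε : 0 < ε) (h : 4 * ε < R - r)
    (ht : t ∉ Icc (r + ε) (R - ε)) : cutoff r R ε t = 0 := by
  rw [mem_Icc, not_and_or, not_le, not_le] at ht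
  unfold cutoff
  rcases ht with ht | ht
  · rw [ramp_of_le_one ((div_le_one hε).2 (by linarith)),
      ramp_of_two_le ((le_div_iff₀ hε).2 (by linarith))]
    ring
  · rw [ramp_of_two_le ((le_div_iff₀ hε).2 (by linarith)),
      ramp_of_le_one ((div_le_one hε).2 (by linarith))]
    ring

lemma cutoff_mem_Icc {r R ε : ℝ} (hε : 0 < ε) (h : 4 * ε < R - r) (t : ℝ) :
    cutoff r R ε t ∈ Icc (0 : ℝ) 1 := by
  have h0 : ∀ s, 0 ≤ ramp s := fun s ↦ Real.smoothTransition.nonneg _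
  have h1 : ∀ s, ramp s ≤ 1 := fun s ↦ Real.smoothTransition.le_one _
  unfold cutoff
  rcases le_total t ((r + R) / 2) with ht | ht
  · rw [ramp_of_two_le (s := (R - t) / ε) ((le_div_iff₀ hε).2 (by linarith))]
    constructor <;> linarith [h0 ((t - r) / ε), h1 ((t - r) / ε)]
  · rw [ramp_of_two_le (s := (t - r) / ε) ((le_div_iff₀ hε).2 (by linarith))]
    constructor <;> linarith [h0 ((R - t) / ε), h1 ((R - t) / ε)]

lemma cutoff_eq_one {r R ε t : ℝ} (hε : 0 < ε) (h : 2 * ε ≤ min (t - r) (R - t)) :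
    cutoff r R ε t = 1 := by
  unfold cutoff
  rw [ramp_of_two_le ((le_div_iff₀ hε).2 (h.trans (min_le_left _ _))),
    ramp_of_two_le ((le_div_iff₀ hε).2 (h.trans (min_le_right _ _)))]
  ring

lemma cutoffDeriv_eq_zero_of_mem {r R ε t : ℝ} (hε : 0 < ε) (h : 2 * ε ≤ min (t - r) (R - t)) :
    cutoffDeriv r R ε t = 0 := by
  have h1 : 2 ≤ (t - r) / ε := (le_div_iff₀ hε).2 (h.trans (min_le_left _ _))
  have h2 : 2 ≤ (R - t) / ε := (le_div_iff₀ hε).2 (h.trans (min_le_right _ _))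
  unfold cutoffDeriv
  rw [deriv_ramp_eq_zero fun h' ↦ by linarith [h'.2],
    deriv_ramp_eq_zero fun h' ↦ by linarith [h'.2]]
  simp

lemma cutoffDeriv_eq_zero_of_notMem {r R ε t : ℝ} (hε : 0 < ε) (h : 4 * ε < R - r)
    (ht : t ∉ Icc (r + ε) (R - ε)) : cutoffDeriv r R ε t = 0 := by
  rw [mem_Icc, not_and_or, not_le, not_le] at ht
  unfold cutoffDeriv
  rcases ht with ht | ht
  · have h1 : (t - r) / ε ≤ 1 := (div_le_one hε).2 (by linarith)
    have h2 : 2 ≤ (R - t) / ε := (le_div_iff₀ hε).2 (by linarith)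
    rw [deriv_ramp_eq_zero fun h' ↦ by linarith [h'.1],
      deriv_ramp_eq_zero fun h' ↦ by linarith [h'.2]]
    simp
  · have h1 : (R - t) / ε ≤ 1 := (div_le_one hε).2 (by linarith)
    have h2 : 2 ≤ (t - r) / ε := (le_div_iff₀ hε).2 (by linarith)
    rw [deriv_ramp_eq_zero fun h' ↦ by linarith [h'.2],
      deriv_ramp_eq_zero fun h' ↦ by linarith [h'.1]]
    simp

lemma exists_bound_cutoffDeriv :
    ∃ B : ℝ, 0 < B ∧ ∀ r R ε t : ℝ, 0 < ε → |cutoffDeriv r R ε t| ≤ B / ε := by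
  obtain ⟨B, hB, h⟩ := exists_bound_ramp
  refine ⟨2 * B, by positivity, fun r R ε t hε ↦ ?_⟩
  unfold cutoffDeriv
  rw [abs_div, abs_of_pos hε]
  gcongr
  refine (abs_sub _ _).trans ?_
  linarith [(h ((t - r) / ε)).1, (h ((R - t) / ε)).1]

lemma tendsto_integral_cutoff_mul {d : ℕ} {r R : ℝ} (hrR : r < R)
    {m : EuclideanSpace ℝ (Fin d) → ℝ} (hm : IntegrableOn m (annulus d r R)) :
    Tendsto (fun ε ↦ ∫ x in annulus d r R, cutoff r R ε ‖x‖ * m x) (𝓝[>] 0)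
      (𝓝 (∫ x in annulus d r R, m x)) := by
  refine tendsto_integral_filter_of_dominated_convergence (fun x ↦ ‖m x‖) ?_ ?_ hm.norm ?_
  · refine Eventually.of_forall fun ε ↦ AEStronglyMeasurable.mul ?_ hm.aestronglyMeasurable
    exact ((contDiff_cutoff r R ε).continuous.comp continuous_norm).aestronglyMeasurable
  · filter_upwards [Ioo_mem_nhdsGT (show (0 : ℝ) < (R - r) / 4 by linarith)] with ε hε
    refine Eventually.of_forall fun x ↦ ?_
    have h := cutoff_mem_Icc (r := r) (R := R) hε.1 (by linarith [hε.2]) ‖x‖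
    rw [norm_mul, Real.norm_of_nonneg h.1]
    exact mul_le_of_le_one_left (norm_nonneg _) h.2
  · filter_upwards [ae_restrict_mem (isOpen_annulus d r R).measurableSet] with x hx
    have hpos : 0 < min (‖x‖ - r) (R - ‖x‖) := lt_min (by linarith [hx.1]) (by linarith [hx.2])
    refine tendsto_const_nhds.congr' ?_
    filter_upwards [Ioo_mem_nhdsGT (half_pos hpos)] with ε hε
    rw [cutoff_eq_one hε.1 (by linarith [hε.2]), one_mul]

lemma tendsto_integral_cutoffDeriv_mul {d : ℕ} {r R M : ℝ}
    {m : EuclideanSpace ℝ (Fin d) → ℝ}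
    (hm : AEStronglyMeasurable m (volume.restrict (annulus d r R)))
    (hM : ∀ x ∈ annulus d r R, |m x| ≤ M * min (‖x‖ - r) (R - ‖x‖)) :
    (∀ᶠ ε in 𝓝[>] 0, IntegrableOn (fun x ↦ cutoffDeriv r R ε ‖x‖ * m x) (annulus d r R)) ∧
    Tendsto (fun ε ↦ ∫ x in annulus d r R, cutoffDeriv r R ε ‖x‖ * m x) (𝓝[>] 0) (𝓝 0) := by
  obtain ⟨B, hB, hBd⟩ := exists_bound_cutoffDeriv
  have hfin : IntegrableOn (fun _ ↦ 2 * B * M) (annulus d r R) := by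
    refine integrableOn_const ?_
    exact ((isCompact_closedAnnulus d r R).measure_lt_top.trans_le' <| measure_mono
      fun x hx ↦ ⟨hx.1.le, hx.2.le⟩).ne
  have hmeas : ∀ ε, AEStronglyMeasurable (fun x ↦ cutoffDeriv r R ε ‖x‖ * m x)
      (volume.restrict (annulus d r R)) := fun ε ↦ AEStronglyMeasurable.mul
    ((contDiff_cutoffDeriv r R ε).continuous.comp continuous_norm).aestronglyMeasurable hm
  have hbd : ∀ ε > 0, ∀ x ∈ annulus d r R, ‖cutoffDeriv r R ε ‖x‖ * m x‖ ≤ 2 * B * M := by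
    intro ε hε x hx
    have hpos : 0 < min (‖x‖ - r) (R - ‖x‖) := lt_min (by linarith [hx.1]) (by linarith [hx.2])
    have hM0 : 0 ≤ M := by
      by_contra hneg
      have := (abs_nonneg _).trans (hM x hx)
      nlinarith
    rcases le_or_gt (2 * ε) (min (‖x‖ - r) (R - ‖x‖)) with h | h
    · rw [cutoffDeriv_eq_zero_of_mem hε h]
      simp only [zero_mul, norm_zero]
      positivity
    · rw [norm_mul, Real.norm_eq_abs, Real.norm_eq_abs]
      calc _ ≤ B / ε * (M * (2 * ε)) := by
            gcongr
            · exact hBd r R ε _ hε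
            · exact (hM x hx).trans (by gcongr)
        _ = 2 * B * M := by field_simp
  have hae := ae_restrict_mem (μ := volume) (isOpen_annulus d r R).measurableSet
  refine ⟨?_, ?_⟩
  · filter_upwards [self_mem_nhdsWithin] with ε hε
    exact Integrable.mono' hfin (hmeas ε) (by filter_upwards [hae] with x hx using hbd ε hε x hx)
  · suffices h : Tendsto (fun ε ↦ ∫ x in annulus d r R, cutoffDeriv r R ε ‖x‖ * m x) (𝓝[>] 0)
        (𝓝 (∫ x in annulus d r R, (0 : ℝ))) by simpa using h
    refine tendsto_integral_filter_of_dominated_convergence (fun _ ↦ 2 * B * M)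
      (Eventually.of_forall hmeas) ?_ hfin ?_
    · filter_upwards [self_mem_nhdsWithin] with ε hε
      filter_upwards [hae] with x hx using hbd ε hε x hx
    · filter_upwards [hae] with x hx
      have hpos : 0 < min (‖x‖ - r) (R - ‖x‖) := lt_min (by linarith [hx.1]) (by linarith [hx.2])
      refine tendsto_const_nhds.congr' ?_
      filter_upwards [Ioo_mem_nhdsGT (half_pos hpos)] with ε hε
      rw [cutoffDeriv_eq_zero_of_mem hε.1 (by linarith [hε.2]), zero_mul]

lemma abs_one_div_mul_min_le {a b c : ℝ} (h : min a b ≤ c) (hc : 0 < c) :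
    |1 / c| * min a b ≤ 1 := by
  rw [abs_of_pos (by positivity), one_div, inv_mul_le_iff₀ hc]
  simpa using h

lemma exists_weight_of_log_deriv {d : ℕ} (hd : 2 ≤ d) {r R lam M : ℝ} (hr : 0 < r)
    {γ γ' : ℝ → ℝ} (hγ : ContDiffOn ℝ 1 γ (Ioo r R))
    (hγ' : ∀ t ∈ Ioo r R, HasDerivAt γ (γ' t) t)
    (hle : ∀ t ∈ Ioo r R, γ' t + γ t ^ 2 - (d - 1) * (d - 3) / (4 * t ^ 2) ≤ -lam)
    (hM : ∀ t ∈ Ioo r R, |γ t| * min (t - r) (R - t) ≤ M) :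
    ∃ (κ κ' : ℝ → ℝ) (M : ℝ), ContDiffOn ℝ 1 κ (Ioo r R) ∧
      (∀ t ∈ Ioo r R, HasDerivAt κ (κ' t) t) ∧
      (∀ t ∈ Ioo r R, κ' t * t + d * κ t + (κ t * t) ^ 2 ≤ -lam) ∧
      ∀ t ∈ Ioo r R, |κ t * t| * min (t - r) (R - t) ≤ M := by
  have hd' : (2 : ℝ) ≤ d := by exact_mod_cast hd
  refine ⟨fun t ↦ (γ t - (d - 1) / 2 / t) / t,
    fun t ↦ ((γ' t + (d - 1) / 2 / t ^ 2) * t - (γ t - (d - 1) / 2 / t)) / t ^ 2,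
    M + (d - 1) / 2 / r * (R - r), ?_, ?_, ?_, ?_⟩
  · exact (hγ.sub (contDiffOn_const.div contDiffOn_id fun t ht ↦ (hr.trans ht.1).ne')).div
      contDiffOn_id fun t ht ↦ (hr.trans ht.1).ne'
  · intro t ht
    have ht0 : t ≠ 0 := (hr.trans ht.1).ne'
    refine (((hγ' t ht).sub ((hasDerivAt_const t (((d : ℝ) - 1) / 2)).div
      (hasDerivAt_id t) ht0)).div (hasDerivAt_id t) ht0).congr_deriv ?_
    simp
    field_simp
    ring
  · intro t ht
    have ht0 : t ≠ 0 := (hr.trans ht.1).ne'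
    refine le_of_eq_of_le ?_ (hle t ht)
    field_simp
    ring
  · intro t ht
    have ht0 : 0 < t := hr.trans ht.1
    have hmin : 0 < min (t - r) (R - t) := lt_min (by linarith [ht.1]) (by linarith [ht.2])
    have hmin' : min (t - r) (R - t) ≤ R - r := (min_le_left _ _).trans (by linarith [ht.2])
    have h1 : (γ t - (d - 1) / 2 / t) / t * t = γ t - (d - 1) / 2 / t := by field_simp
    have h2 : |((d : ℝ) - 1) / 2 / t| ≤ (d - 1) / 2 / r := by
      have : (0 : ℝ) ≤ (d - 1) / 2 := by linarith
      rw [abs_of_nonneg (by positivity)]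
      gcongr
      exact ht.1.le
    simp only [h1]
    calc |γ t - (d - 1) / 2 / t| * min (t - r) (R - t)
        ≤ (|γ t| + |((d : ℝ) - 1) / 2 / t|) * min (t - r) (R - t) := by
          gcongr; exact abs_sub _ _
      _ ≤ M + (d - 1) / 2 / r * (R - r) := by
          rw [add_mul]
          refine add_le_add (hM t ht) ?_
          have : 0 ≤ |((d : ℝ) - 1) / 2 / t| := abs_nonneg _
          have : 0 ≤ ((d : ℝ) - 1) / 2 / r := div_nonneg (by linarith) hr.le
          gcongr

lemma exists_weight {d : ℕ} (hd : 2 ≤ d) {r R : ℝ} (hr : 0 < r) (hrR : r < R) :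
    ∃ (κ κ' : ℝ → ℝ) (M : ℝ), ContDiffOn ℝ 1 κ (Ioo r R) ∧
      (∀ t ∈ Ioo r R, HasDerivAt κ (κ' t) t) ∧
      (∀ t ∈ Ioo r R, κ' t * t + d * κ t + (κ t * t) ^ 2 ≤
        -(1 / (max (1 / (2 * (d : ℝ))) (1 / 8) * (R - r) ^ 2))) ∧
      ∀ t ∈ Ioo r R, |κ t * t| * min (t - r) (R - t) ≤ M := by
  have hh : 0 < R - r := by linarith
  have hs : ∀ t ∈ Ioo r R, t - r ≠ 0 := fun t ht ↦ by linarith [ht.1]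
  have hs' : ∀ t ∈ Ioo r R, R - t ≠ 0 := fun t ht ↦ by linarith [ht.2]
  have hsum : ∀ t ∈ Ioo r R, R - r + (t - r) ≠ 0 := fun t ht ↦ by linarith [ht.1]
  have hmin : ∀ t ∈ Ioo r R, 0 < min (t - r) (R - t) := fun t ht ↦
    lt_min (by linarith [ht.1]) (by linarith [ht.2])
  have hd1 : ∀ t ∈ Ioo r R, HasDerivAt (fun t ↦ 1 / (t - r)) (-1 / (t - r) ^ 2) t := fun t ht ↦ by
    exact ((hasDerivAt_const t (1 : ℝ)).div ((hasDerivAt_id t).sub_const r) (hs t ht)).congr_deriv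
      (by simp)
  have hd2 : ∀ t ∈ Ioo r R, HasDerivAt (fun t ↦ 1 / (R - t)) (1 / (R - t) ^ 2) t := fun t ht ↦ by
    exact ((hasDerivAt_const t (1 : ℝ)).div ((hasDerivAt_id t).const_sub R) (hs' t ht)).congr_deriv
      (by simp)
  have hd3 : ∀ t ∈ Ioo r R, HasDerivAt (fun t ↦ 1 / (R - r + (t - r)))
      (-1 / (R - r + (t - r)) ^ 2) t := fun t ht ↦ by
    exact ((hasDerivAt_const t (1 : ℝ)).div (((hasDerivAt_id t).sub_const r).const_add (R - r))
      (hsum t ht)).congr_deriv (by simp)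
  have hc1 : ContDiffOn ℝ 1 (fun t ↦ 1 / (t - r)) (Ioo r R) :=
    contDiffOn_const.div (contDiffOn_id.sub contDiffOn_const) hs
  have hc2 : ContDiffOn ℝ 1 (fun t ↦ 1 / (R - t)) (Ioo r R) :=
    contDiffOn_const.div (contDiffOn_const.sub contDiffOn_id) hs'
  have hc3 : ContDiffOn ℝ 1 (fun t ↦ 1 / (R - r + (t - r))) (Ioo r R) :=
    contDiffOn_const.div (contDiffOn_const.add (contDiffOn_id.sub contDiffOn_const)) hsum
  have hb1 : ∀ t ∈ Ioo r R, |1 / (t - r)| * min (t - r) (R - t) ≤ 1 := fun t ht ↦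
    abs_one_div_mul_min_le (min_le_left _ _)
      (by linarith [ht.1])
  have hb2 : ∀ t ∈ Ioo r R, |1 / (R - t)| * min (t - r) (R - t) ≤ 1 := fun t ht ↦
    abs_one_div_mul_min_le (min_le_right _ _)
      (by linarith [ht.2])
  have hb3 : ∀ t ∈ Ioo r R, |1 / (R - r + (t - r))| * min (t - r) (R - t) ≤ 1 := fun t ht ↦
    abs_one_div_mul_min_le
      ((min_le_left _ _).trans (by linarith)) (by linarith [ht.1])
  rcases hd.eq_or_lt with rfl | hd3'
  · have hC : 1 / (max (1 / (2 * ((2 : ℕ) : ℝ))) (1 / 8) * (R - r) ^ 2) = 4 / (R - r) ^ 2 := by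
      norm_num
      ring
    rw [hC]
    refine exists_weight_of_log_deriv (M := 5 / 2) le_rfl hr
      (γ := fun t ↦ 1 / 2 * (1 / (t - r)) - 1 / (R - t) + 1 / (R - r + (t - r)))
      (γ' := fun t ↦ 1 / 2 * (-1 / (t - r) ^ 2) - 1 / (R - t) ^ 2 + -1 / (R - r + (t - r)) ^ 2)
      (((contDiffOn_const.mul hc1).sub hc2).add hc3)
      (fun t ht ↦ (((hd1 t ht).const_mul (1 / 2)).sub (hd2 t ht)).add (hd3 t ht)) ?_ ?_
    · intro t ht
      have e1 : t - r ≠ 0 := hs t ht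
      have e2 : R - t ≠ 0 := hs' t ht
      have e3 : R - r + (t - r) ≠ 0 := hsum t ht
      have p1 : 0 < t - r := by linarith [ht.1]
      have p2 : 0 < R - t := by linarith [ht.2]
      have i1 : 1 / (4 * t ^ 2) ≤ 1 / (4 * (t - r) ^ 2) := by
        gcongr; linarith
      have i2 : 4 / (R - r) ^ 2 ≤ 4 / ((R - t) * (R - r + (t - r))) := by
        refine div_le_div_of_nonneg_left (by norm_num) (by nlinarith) ?_
        nlinarith
      have i3 : 1 / 2 * (-1 / (t - r) ^ 2) - 1 / (R - t) ^ 2 + -1 / (R - r + (t - r)) ^ 2 +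
          (1 / 2 * (1 / (t - r)) - 1 / (R - t) + 1 / (R - r + (t - r))) ^ 2 +
          1 / (4 * (t - r) ^ 2) = -(4 / ((R - t) * (R - r + (t - r)))) := by
        field_simp
        ring
      have i4 : (((2 : ℕ) : ℝ) - 1) * (((2 : ℕ) : ℝ) - 3) / (4 * t ^ 2) = -(1 / (4 * t ^ 2)) := by
        norm_num
        ring
      simp only [i4]
      linarith
    · intro t ht
      have := (hmin t ht).le
      calc _ ≤ (1 / 2 * |1 / (t - r)| + |1 / (R - t)| + |1 / (R - r + (t - r))|) *
            min (t - r) (R - t) := by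
            gcongr
            refine (abs_add_le _ _).trans ?_
            gcongr
            refine (abs_sub _ _).trans ?_
            rw [abs_mul]
            norm_num
        _ ≤ 5 / 2 := by nlinarith [hb1 t ht, hb2 t ht, hb3 t ht]
  · have hd3 : (3 : ℝ) ≤ d := by exact_mod_cast hd3'
    have hC : 1 / (max (1 / (2 * (d : ℝ))) (1 / 8) * (R - r) ^ 2) ≤ 8 / (R - r) ^ 2 := by
      have : (1 : ℝ) / 8 ≤ max (1 / (2 * (d : ℝ))) (1 / 8) := le_max_right _ _
      calc _ ≤ 1 / (1 / 8 * (R - r) ^ 2) := by gcongr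
        _ = 8 / (R - r) ^ 2 := by field_simp
    refine exists_weight_of_log_deriv (M := 2) hd hr
      (γ := fun t ↦ 1 / (t - r) - 1 / (R - t))
      (γ' := fun t ↦ -1 / (t - r) ^ 2 - 1 / (R - t) ^ 2)
      (hc1.sub hc2) (fun t ht ↦ (hd1 t ht).sub (hd2 t ht)) ?_ ?_
    · intro t ht
      have e1 : t - r ≠ 0 := hs t ht
      have e2 : R - t ≠ 0 := hs' t ht
      have p1 : 0 < t - r := by linarith [ht.1]
      have p2 : 0 < R - t := by linarith [ht.2]
      have i1 : 0 ≤ ((d : ℝ) - 1) * (d - 3) / (4 * t ^ 2) := by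
        refine div_nonneg (mul_nonneg ?_ ?_) ?_
        · linarith
        · linarith
        · positivity
      have i2 : 8 / (R - r) ^ 2 ≤ 2 / ((t - r) * (R - t)) := by
        rw [div_le_div_iff₀ (by positivity) (by positivity)]
        nlinarith [sq_nonneg ((t - r) - (R - t))]
      have i3 : -1 / (t - r) ^ 2 - 1 / (R - t) ^ 2 + (1 / (t - r) - 1 / (R - t)) ^ 2 =
          -(2 / ((t - r) * (R - t))) := by
        field_simp
        ring
      linarith
    · intro t ht
      have := (hmin t ht).le
      calc _ ≤ (|1 / (t - r)| + |1 / (R - t)|) * min (t - r) (R - t) := by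
            gcongr
            exact abs_sub _ _
        _ ≤ 2 := by linarith [hb1 t ht, hb2 t ht]

/-- Poincaré type inequality on an annulus for functions vanishing linearly on the boundary. -/
lemma poincare_annulus {d : ℕ} (hd : 2 ≤ d) {r R M : ℝ} (hr : 0 < r) (hrR : r < R)
    {E : EuclideanSpace ℝ (Fin d) → ℝ} (hE : ContDiffOn ℝ 2 E (annulus d r R))
    (hEM : ∀ x ∈ annulus d r R, |E x| ≤ M * min (‖x‖ - r) (R - ‖x‖))
    (hE' : ∀ x ∈ annulus d r R, |fderiv ℝ E x x / ‖x‖| ≤ M)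
    (hE2 : IntegrableOn (fun x ↦ E x ^ 2) (annulus d r R))
    (hEL : IntegrableOn (fun x ↦ E x * laplacian E x) (annulus d r R)) :
    ∫ x in annulus d r R, E x ^ 2 ≤ max (1 / (2 * (d : ℝ))) (1 / 8) * (R - r) ^ 2 *
      -∫ x in annulus d r R, E x * laplacian E x := by
  obtain ⟨κ, κ', M₁, hκ, hκ', hκle, hκM⟩ := exists_weight hd hr hrR
  set C : ℝ := max (1 / (2 * (d : ℝ))) (1 / 8) with hC
  have hC0 : 0 < C * (R - r) ^ 2 := by
    have : (0 : ℝ) < C := (by norm_num : (0 : ℝ) < 1 / 8).trans_le (le_max_right _ _)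
    have : 0 < R - r := by linarith
    positivity
  set lam : ℝ := 1 / (C * (R - r) ^ 2) with hlam
  have hΩ := isOpen_annulus d r R
  set m : EuclideanSpace ℝ (Fin d) → ℝ := fun x ↦ -(lam * E x ^ 2) - E x * laplacian E x with hm
  have hmint : IntegrableOn m (annulus d r R) := (hE2.const_mul lam).neg.sub hEL
  set A : EuclideanSpace ℝ (Fin d) → ℝ := fun x ↦
    E x ^ 2 * κ ‖x‖ * ‖x‖ - E x * (fderiv ℝ E x x / ‖x‖) with hA
  have hAc : ContinuousOn A (annulus d r R) := by
    have h1 := hE.continuousOn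
    have h2 : ContinuousOn (fun x : EuclideanSpace ℝ (Fin d) ↦ κ ‖x‖) (annulus d r R) :=
      (contDiffOn_comp_norm hr hκ).continuousOn
    have h3 : ContinuousOn (fun x ↦ fderiv ℝ E x x) (annulus d r R) :=
      (hE.continuousOn_fderiv_of_isOpen hΩ (by norm_num)).clm_apply continuousOn_id
    have h4 : ContinuousOn (fun x : EuclideanSpace ℝ (Fin d) ↦ ‖x‖) (annulus d r R) :=
      continuous_norm.continuousOn
    exact (((h1.pow 2).mul h2).mul h4).sub
      (h1.mul (h3.div h4 fun x hx ↦ (hr.trans hx.1).ne'))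
  have hAM : ∀ x ∈ annulus d r R, |A x| ≤ (M ^ 2 * M₁ + M ^ 2) * min (‖x‖ - r) (R - ‖x‖) := by
    intro x hx
    set δ := min (‖x‖ - r) (R - ‖x‖) with hδ
    have hpos : 0 < δ := lt_min (by linarith [hx.1]) (by linarith [hx.2])
    have h1 := hEM x hx
    have h2 := hE' x hx
    have h3 := hκM ‖x‖ hx
    have hM0 : 0 ≤ M := (abs_nonneg _).trans h2
    calc |A x| ≤ |E x| ^ 2 * |κ ‖x‖ * ‖x‖| + |E x| * |fderiv ℝ E x x / ‖x‖| := by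
          rw [← abs_pow, ← abs_mul, ← abs_mul, ← mul_assoc]
          exact abs_sub _ _
      _ ≤ (M * δ) ^ 2 * |κ ‖x‖ * ‖x‖| + (M * δ) * M := by gcongr
      _ = M ^ 2 * δ * (|κ ‖x‖ * ‖x‖| * δ) + M ^ 2 * δ := by ring
      _ ≤ M ^ 2 * δ * M₁ + M ^ 2 * δ := by gcongr
      _ = _ := by ring
  obtain ⟨hAint, hAlim⟩ := tendsto_integral_cutoffDeriv_mul
    (hAc.aestronglyMeasurable hΩ.measurableSet) hAM
  have hmlim := tendsto_integral_cutoff_mul hrR hmint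
  have hlim := hAlim.add hmlim
  have hnonneg : 0 ≤ 0 + ∫ x in annulus d r R, m x := by
    refine ge_of_tendsto hlim ?_
    filter_upwards [hAint, Ioo_mem_nhdsGT (show (0 : ℝ) < (R - r) / 4 by linarith)] with ε hAε hε
    have hε0 : 0 < ε := hε.1
    have hε4 : 4 * ε < R - r := by linarith [hε.2]
    obtain ⟨hg, hg0⟩ := integral_picone_eq_zero (E := E) hr (a := r + ε) (b := R - ε)
      (by linarith) (by linarith) (contDiff_cutoff r R ε) (hasDerivAt_cutoff r R ε)
      (fun t ht ↦ cutoff_eq_zero hε0 hε4 ht) hκ hκ' hE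
    have hφm : IntegrableOn (fun x ↦ cutoff r R ε ‖x‖ * m x) (annulus d r R) := by
      refine Integrable.bdd_mul (c := 1) hmint
        ((contDiff_cutoff r R ε).continuous.comp continuous_norm).aestronglyMeasurable ?_
      refine Eventually.of_forall fun x ↦ ?_
      have := cutoff_mem_Icc hε0 hε4 ‖x‖
      rw [Real.norm_of_nonneg this.1]
      exact this.2
    rw [← integral_add hAε hφm, ← hg0]
    refine setIntegral_mono_on hg (hAε.add hφm) hΩ.measurableSet fun x hx ↦ ?_
    have hφ0 := (cutoff_mem_Icc hε0 hε4 ‖x‖).1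
    simp only [hA, hm]
    refine add_le_add le_rfl (mul_le_mul_of_nonneg_left ?_ hφ0)
    have hsq : 0 ≤ ∑ i, (fderiv ℝ E x (EuclideanSpace.single i 1) - E x * κ ‖x‖ * x i) ^ 2 :=
      Finset.sum_nonneg fun i _ ↦ sq_nonneg _
    have hexp : ∑ i, (fderiv ℝ E x (EuclideanSpace.single i 1) - E x * κ ‖x‖ * x i) ^ 2 =
        ∑ i, fderiv ℝ E x (EuclideanSpace.single i 1) * fderiv ℝ E x (EuclideanSpace.single i 1)
        - 2 * E x * κ ‖x‖ * fderiv ℝ E x x + E x ^ 2 * (κ ‖x‖ * ‖x‖) ^ 2 := by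
      rw [fderiv_apply_self_eq_sum, mul_pow, ← sum_sq_eq_norm_sq, Finset.mul_sum, Finset.mul_sum,
        Finset.mul_sum, ← Finset.sum_sub_distrib, ← Finset.sum_add_distrib]
      exact Finset.sum_congr rfl fun i _ ↦ by ring
    have hw := mul_le_mul_of_nonneg_left (hκle ‖x‖ hx) (sq_nonneg (E x))
    nlinarith
  rw [zero_add] at hnonneg
  have hmeq : ∫ x in annulus d r R, m x =
      -(lam * ∫ x in annulus d r R, E x ^ 2) - ∫ x in annulus d r R, E x * laplacian E x := by
    rw [← integral_const_mul, ← integral_neg]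
    exact integral_sub (hE2.const_mul lam).neg hEL
  rw [hmeq, hlam, one_div, inv_mul_eq_div] at hnonneg
  rw [← div_le_iff₀' hC0]
  linarith

lemma exists_measureReal_annulus_le (d : ℕ) (R : ℝ) :
    ∃ C : ℝ, 0 ≤ C ∧ ∀ a b : ℝ, 0 ≤ a → a ≤ b → b ≤ R →
      (volume : Measure (EuclideanSpace ℝ (Fin d))).real (annulus d a b) ≤ C * (b - a) := by
  set v := (volume : Measure (EuclideanSpace ℝ (Fin d))).real (ball 0 1) with hv
  refine ⟨d * |R| ^ (d - 1) * v, by positivity, fun a b ha hab hb ↦ ?_⟩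
  have hsub : annulus d a b ⊆ closedBall 0 b \ closedBall 0 a := fun x hx ↦ by
    simpa using ⟨hx.2.le, hx.1⟩
  have hball : ∀ s : ℝ, 0 ≤ s →
      (volume : Measure (EuclideanSpace ℝ (Fin d))).real (closedBall 0 s) = s ^ d * v := by
    intro s hs
    rw [hv, measureReal_def, Measure.addHaar_closedBall _ _ hs, ENNReal.toReal_mul,
      ENNReal.toReal_ofReal (by positivity), finrank_euclideanSpace_fin, measureReal_def]
  calc _ ≤ volume.real (closedBall (0 : EuclideanSpace ℝ (Fin d)) b \ closedBall 0 a) :=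
        measureReal_mono hsub
          (measure_ne_top_of_subset sdiff_subset measure_closedBall_lt_top.ne)
    _ = (b ^ d - a ^ d) * v := by
        rw [measureReal_sdiff (closedBall_subset_closedBall hab) measurableSet_closedBall
          measure_closedBall_lt_top.ne,
          hball _ ha, hball _ (ha.trans hab), sub_mul]
    _ ≤ (b - a) * d * |R| ^ (d - 1) * v := by
        gcongr
        have h := abs_pow_sub_pow_le b a d
        rw [abs_of_nonneg (sub_nonneg.2 hab), abs_of_nonneg ha, abs_of_nonneg (ha.trans hab),
          max_eq_left hab] at h
        refine (le_abs_self _).trans (h.trans ?_)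
        gcongr
        · exact ha.trans hab
        · exact hb.trans (le_abs_self _)
    _ = _ := by ring

lemma exists_bound_cutoffDerivTwo :
    ∃ B : ℝ, 0 < B ∧ ∀ r R ε t : ℝ, |cutoffDerivTwo r R ε t| ≤ B / ε ^ 2 := by
  obtain ⟨B, hB, h⟩ := exists_bound_ramp
  refine ⟨2 * B, by positivity, fun r R ε t ↦ ?_⟩
  unfold cutoffDerivTwo
  rw [abs_div, abs_of_nonneg (sq_nonneg ε)]
  gcongr
  refine (abs_add_le _ _).trans ?_
  linarith [(h ((t - r) / ε)).2, (h ((R - t) / ε)).2]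

lemma cutoffDerivTwo_eq_zero_of_mem {r R ε t : ℝ} (hε : 0 < ε)
    (h : 2 * ε ≤ min (t - r) (R - t)) : cutoffDerivTwo r R ε t = 0 := by
  have h1 : 2 ≤ (t - r) / ε := (le_div_iff₀ hε).2 (h.trans (min_le_left _ _))
  have h2 : 2 ≤ (R - t) / ε := (le_div_iff₀ hε).2 (h.trans (min_le_right _ _))
  unfold cutoffDerivTwo
  rw [deriv_deriv_ramp_eq_zero fun h' ↦ by linarith [h'.2],
    deriv_deriv_ramp_eq_zero fun h' ↦ by linarith [h'.2]]
  simp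

/-- The boundary layer terms in Green's formula with a cutoff are controlled by the values of the
functions in the layer. -/
lemma exists_bound_layer (d : ℕ) {r R : ℝ} (hr : 0 < r) (hrR : r < R) :
    ∃ C : ℝ, 0 ≤ C ∧ ∀ ε : ℝ, 0 < ε → 4 * ε < R - r →
      ∀ (E W P : EuclideanSpace ℝ (Fin d) → ℝ) (N η : ℝ), 0 ≤ N → 0 ≤ η →
      (∀ x ∈ annulus d r R, min (‖x‖ - r) (R - ‖x‖) < 2 * ε →
        |E x| ≤ N * ε ∧ |P x| ≤ N ∧ |W x| ≤ η) →
      |∫ x in annulus d r R, (2 * cutoffDeriv r R ε ‖x‖ * (W x * P x) + E x * W x *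
        (cutoffDerivTwo r R ε ‖x‖ + (d - 1) / ‖x‖ * cutoffDeriv r R ε ‖x‖))| ≤ C * (N * η) := by
  obtain ⟨B, hB, hBd⟩ := exists_bound_cutoffDeriv
  obtain ⟨B', hB', hBd'⟩ := exists_bound_cutoffDerivTwo
  obtain ⟨V, hV, hVd⟩ := exists_measureReal_annulus_le d R
  set c : ℝ := 2 * B + B' + |(d : ℝ) - 1| / r * B * R with hc
  have hR : 0 < R := hr.trans hrR
  have hc0 : 0 ≤ c := by positivity
  refine ⟨c * (4 * V), by positivity, fun ε hε hε4 E W P N η hN hη h ↦ ?_⟩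
  set L := annulus d r (r + 2 * ε) ∪ annulus d (R - 2 * ε) R with hL
  have hLmeas : MeasurableSet L :=
    (isOpen_annulus d _ _).measurableSet.union (isOpen_annulus d _ _).measurableSet
  have hLvol : volume.real L ≤ 4 * V * ε := by
    refine (measureReal_union_le _ _).trans ?_
    have h1 := hVd r (r + 2 * ε) hr.le (by linarith) (by linarith)
    have h2 := hVd (R - 2 * ε) R (by linarith) (by linarith) le_rfl
    linarith
  have hLsub : L ⊆ annulus d r R := by
    rintro x (hx | hx)
    · exact ⟨hx.1, hx.2.trans (by linarith)⟩
    · exact ⟨lt_trans (by linarith) hx.1, hx.2⟩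
  have hLfin : volume L < ⊤ := (isCompact_closedAnnulus d r R).measure_lt_top.trans_le' <|
    measure_mono fun x hx ↦ ⟨(hLsub hx).1.le, (hLsub hx).2.le⟩
  rw [setIntegral_eq_of_subset_of_forall_sdiff_eq_zero (isOpen_annulus d r R).measurableSet hLsub]
  · rw [← Real.norm_eq_abs]
    refine (norm_setIntegral_le_of_norm_le_const (C := c / ε * (N * η)) hLfin ?_).trans ?_
    · intro x hx
      have hxΩ := hLsub hx
      have hmin : min (‖x‖ - r) (R - ‖x‖) < 2 * ε := by
        rcases hx with hx | hx
        · exact (min_le_left _ _).trans_lt (by linarith [hx.2])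
        · exact (min_le_right _ _).trans_lt (by linarith [hx.1])
      obtain ⟨h1, h2, h3⟩ := h x hxΩ hmin
      have h4 : |((d : ℝ) - 1) / ‖x‖| ≤ |(d : ℝ) - 1| / r := by
        rw [abs_div, abs_of_pos (hr.trans hxΩ.1)]
        gcongr
        exact hxΩ.1.le
      have h5 := hBd r R ε ‖x‖ hε
      have h6 := hBd' r R ε ‖x‖
      have hεR : ε ≤ R := by linarith
      rw [Real.norm_eq_abs]
      calc _ ≤ 2 * |cutoffDeriv r R ε ‖x‖| * (|W x| * |P x|) + |E x| * |W x| *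
            (|cutoffDerivTwo r R ε ‖x‖| + |((d : ℝ) - 1) / ‖x‖| * |cutoffDeriv r R ε ‖x‖|) := by
            refine (abs_add_le _ _).trans ?_
            simp only [abs_mul, abs_two]
            gcongr
            refine (abs_add_le _ _).trans ?_
            rw [abs_mul]
        _ ≤ 2 * (B / ε) * (η * N) + N * ε * η * (B' / ε ^ 2 + |(d : ℝ) - 1| / r * (B / ε)) := by
            gcongr
        _ = (2 * B + B' + |(d : ℝ) - 1| / r * B * ε) / ε * (N * η) := by
            field_simp
            ring
        _ ≤ c / ε * (N * η) := by
            rw [hc]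
            gcongr
    · calc c / ε * (N * η) * volume.real L ≤ c / ε * (N * η) * (4 * V * ε) := by gcongr
        _ = _ := by field_simp
  · intro x hx
    have h2 : 2 * ε ≤ min (‖x‖ - r) (R - ‖x‖) := by
      by_contra hcon
      refine hx.2 ?_
      rcases min_lt_iff.1 (not_le.1 hcon) with h' | h'
      · exact Or.inl ⟨hx.1.1, by linarith⟩
      · exact Or.inr ⟨by linarith, hx.1.2⟩
    rw [cutoffDeriv_eq_zero_of_mem hε h2, cutoffDerivTwo_eq_zero_of_mem hε h2]
    ring

/-- If the layer quantities are eventually bounded by `N`, then so is the defect in Green's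
formula. -/
lemma exists_bound_green_defect (d : ℕ) {r R : ℝ} (hr : 0 < r) (hrR : r < R) :
    ∃ C : ℝ, 0 ≤ C ∧ ∀ (E W : EuclideanSpace ℝ (Fin d) → ℝ) (N η : ℝ), 0 ≤ N → 0 ≤ η →
      ContDiffOn ℝ 2 E (annulus d r R) → ContDiffOn ℝ 2 W (annulus d r R) →
      IntegrableOn (fun x ↦ W x * laplacian E x - E x * laplacian W x) (annulus d r R) →
      (∀ᶠ ε in 𝓝[>] 0, ∀ x ∈ annulus d r R, min (‖x‖ - r) (R - ‖x‖) < 2 * ε →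
        |E x| ≤ N * ε ∧ |fderiv ℝ E x x / ‖x‖| ≤ N ∧ |W x| ≤ η) →
      |∫ x in annulus d r R, (W x * laplacian E x - E x * laplacian W x)| ≤ C * (N * η) := by
  obtain ⟨C, hC, hCd⟩ := exists_bound_layer d hr hrR
  refine ⟨C, hC, fun E W N η hN hη hE hW hInt h ↦ ?_⟩
  refine le_of_tendsto (tendsto_integral_cutoff_mul hrR hInt).abs ?_
  filter_upwards [h, Ioo_mem_nhdsGT (show (0 : ℝ) < (R - r) / 4 by linarith)] with ε hb hε
  have hε0 : 0 < ε := hε.1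
  have hε4 : 4 * ε < R - r := by linarith [hε.2]
  obtain ⟨hg, hg0⟩ := integral_green_eq_zero (E := E) (U := W) hr (a := r + ε) (b := R - ε)
    (by linarith) (by linarith) (contDiff_cutoff r R ε) (hasDerivAt_cutoff r R ε)
    (contDiff_cutoffDeriv r R ε) (hasDerivAt_cutoffDeriv r R ε)
    (fun t ht ↦ cutoff_eq_zero hε0 hε4 ht) (fun t ht ↦ cutoffDeriv_eq_zero_of_notMem hε0 hε4 ht)
    hE hW
  have hφm : IntegrableOn (fun x ↦ cutoff r R ε ‖x‖ *
      (W x * laplacian E x - E x * laplacian W x)) (annulus d r R) := by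
    refine Integrable.bdd_mul (c := 1) hInt
      ((contDiff_cutoff r R ε).continuous.comp continuous_norm).aestronglyMeasurable ?_
    refine Eventually.of_forall fun x ↦ ?_
    have := cutoff_mem_Icc hε0 hε4 ‖x‖
    rw [Real.norm_of_nonneg this.1]
    exact this.2
  have hlayer := hg.sub hφm
  have hbound := hCd ε hε0 hε4 E W (fun x ↦ fderiv ℝ E x x / ‖x‖) N η hN hη hb
  have hsum := integral_sub hg hφm
  rw [hg0, zero_sub] at hsum
  rw [← abs_neg, ← hsum]
  simpa only [add_sub_cancel_left] using hbound

lemma abs_integral_green_le (d : ℕ) {r R M : ℝ} (hr : 0 < r) (hrR : r < R) :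
    ∃ C : ℝ, 0 ≤ C ∧ ∀ (E W : EuclideanSpace ℝ (Fin d) → ℝ) (η : ℝ), 0 ≤ η →
      ContDiffOn ℝ 2 E (annulus d r R) → ContDiffOn ℝ 2 W (annulus d r R) →
      IntegrableOn (fun x ↦ W x * laplacian E x - E x * laplacian W x) (annulus d r R) →
      (∀ x ∈ annulus d r R, |E x| ≤ M * min (‖x‖ - r) (R - ‖x‖)) →
      (∀ x ∈ annulus d r R, |fderiv ℝ E x x / ‖x‖| ≤ M) →
      (∀ x ∈ annulus d r R, |W x| ≤ η) →
      |∫ x in annulus d r R, (W x * laplacian E x - E x * laplacian W x)| ≤ C * η := by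
  obtain ⟨C, hC, hCd⟩ := exists_bound_green_defect d hr hrR
  refine ⟨C * (2 * |M|), by positivity, fun E W η hη hE hW hInt hEM hPM hWη ↦ ?_⟩
  rw [mul_assoc]
  refine hCd E W (2 * |M|) η (by positivity) hη hE hW hInt ?_
  filter_upwards [self_mem_nhdsWithin] with ε hε x hx hmin
  have hε : 0 < ε := hε
  have hpos : 0 < min (‖x‖ - r) (R - ‖x‖) := lt_min (by linarith [hx.1]) (by linarith [hx.2])
  have hM := le_abs_self M
  refine ⟨(hEM x hx).trans ?_, (hPM x hx).trans (by linarith [abs_nonneg M]), hWη x hx⟩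
  calc _ ≤ |M| * (2 * ε) := by gcongr
    _ = _ := by ring

lemma integral_green_eq_zero_of_boundary {d : ℕ} {r R M : ℝ} (hr : 0 < r) (hrR : r < R)
    {E V : EuclideanSpace ℝ (Fin d) → ℝ} {η : ℝ}
    (hE : ContDiffOn ℝ 2 E (annulus d r R)) (hV : ContDiffOn ℝ 2 V (annulus d r R))
    (hInt : IntegrableOn (fun x ↦ V x * laplacian E x - E x * laplacian V x) (annulus d r R))
    (hEM : ∀ x ∈ annulus d r R, |E x| ≤ M * min (‖x‖ - r) (R - ‖x‖) ^ 2)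
    (hPM : ∀ x ∈ annulus d r R, |fderiv ℝ E x x / ‖x‖| ≤ M * min (‖x‖ - r) (R - ‖x‖))
    (hVη : ∀ x ∈ annulus d r R, |V x| ≤ η) :
    ∫ x in annulus d r R, (V x * laplacian E x - E x * laplacian V x) = 0 := by
  obtain ⟨C, hC, hCd⟩ := exists_bound_green_defect d hr hrR
  set I := |∫ x in annulus d r R, (V x * laplacian E x - E x * laplacian V x)| with hI
  suffices h : I ≤ 0 from abs_nonpos_iff.1 h
  have hlim : Tendsto (fun ε₀ : ℝ ↦ C * ((4 * |M| * ε₀) * |η|)) (𝓝[>] 0)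
      (𝓝 (C * ((4 * |M| * 0) * |η|))) := by
    refine Tendsto.mono_left (Continuous.tendsto ?_ 0) nhdsWithin_le_nhds
    fun_prop
  rw [show C * ((4 * |M| * 0) * |η|) = 0 by ring] at hlim
  refine ge_of_tendsto hlim ?_
  filter_upwards [self_mem_nhdsWithin] with ε₀ hε₀
  have hε₀ : 0 < ε₀ := hε₀
  refine hCd E V (4 * |M| * ε₀) |η| (by positivity) (abs_nonneg _) hE hV hInt ?_
  filter_upwards [Ioc_mem_nhdsGT hε₀] with ε hε x hx hmin
  have hε0 : 0 < ε := hε.1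
  have hpos : 0 < min (‖x‖ - r) (R - ‖x‖) := lt_min (by linarith [hx.1]) (by linarith [hx.2])
  have hM := le_abs_self M
  have hM0 := abs_nonneg M
  refine ⟨(hEM x hx).trans ?_, (hPM x hx).trans ?_, (hVη x hx).trans (le_abs_self _)⟩
  · calc _ ≤ |M| * (2 * ε) ^ 2 := by gcongr
      _ = 4 * |M| * ε * ε := by ring
      _ ≤ _ := by gcongr; exact hε.2
  · calc _ ≤ |M| * (2 * ε) := by gcongr
      _ ≤ |M| * (2 * ε₀) := by gcongr; exact hε.2
      _ ≤ _ := by nlinarith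

lemma uniqueDiffOn_closedAnnulus (d : ℕ) {a b : ℝ} (ha : 0 < a) (hab : a < b) :
    UniqueDiffOn ℝ (closedAnnulus d a b) := by
  intro x hx
  have hx0 : 0 < ‖x‖ := ha.trans_le hx.1
  set c : EuclideanSpace ℝ (Fin d) := ((a + b) / 2 / ‖x‖) • x with hc
  have hcn : ‖c‖ = (a + b) / 2 := by
    have hb : 0 < b := ha.trans hab
    rw [hc, norm_smul, Real.norm_of_nonneg (by positivity)]
    field_simp
  have hxc : x ∈ closedBall c ((b - a) / 2) := by
    have : x - c = (1 - (a + b) / 2 / ‖x‖) • x := by rw [sub_smul, one_smul]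
    have h2 : (1 - (a + b) / 2 / ‖x‖) * ‖x‖ = ‖x‖ - (a + b) / 2 := by field_simp
    rw [mem_closedBall, dist_eq_norm, this, norm_smul, Real.norm_eq_abs, ← abs_of_pos hx0,
      ← abs_mul, abs_of_pos hx0, h2, abs_le]
    constructor <;> linarith [hx.1, hx.2]
  have hsub : closedBall c ((b - a) / 2) ⊆ closedAnnulus d a b := by
    intro y hy
    rw [mem_closedBall, dist_eq_norm] at hy
    have h1 := abs_le.1 ((abs_norm_sub_norm_le y c).trans hy)
    rw [hcn] at h1
    constructor <;> linarith [h1.1, h1.2]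
  refine (uniqueDiffWithinAt_convex (convex_closedBall c _) ?_ (subset_closure hxc)).mono hsub
  exact ⟨c, ball_subset_interior_closedBall (mem_ball_self (by linarith))⟩

lemma closedAnnulus_mem_nhds {d : ℕ} {a b : ℝ} {x : EuclideanSpace ℝ (Fin d)}
    (hx : x ∈ annulus d a b) : closedAnnulus d a b ∈ 𝓝 x :=
  mem_of_superset ((isOpen_annulus d a b).mem_nhds hx) fun _ hy ↦ ⟨hy.1.le, hy.2.le⟩

/-- Mean value inequality along a ray. -/
lemma norm_sub_le_of_ray {X V : Type*} [NormedAddCommGroup X] [NormedSpace ℝ X]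
    [NormedAddCommGroup V] [NormedSpace ℝ V] {f : X → V} {f' : X → X →L[ℝ] V} {K : Set X} {ω : X}
    {p q C : ℝ} (hK : ∀ s ∈ Icc p q, s • ω ∈ K)
    (hf : ∀ x ∈ K, HasFDerivWithinAt f (f' x) K x)
    (hC : ∀ s ∈ Icc p q, ‖f' (s • ω) ω‖ ≤ C) {s t : ℝ} (hs : s ∈ Icc p q) (ht : t ∈ Icc p q) :
    ‖f (t • ω) - f (s • ω)‖ ≤ C * |t - s| := by
  refine Convex.norm_image_sub_le_of_norm_hasDerivWithin_le (f := fun s ↦ f (s • ω))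
    (fun s hs ↦ ?_) hC (convex_Icc p q) hs ht
  have h1 : HasDerivWithinAt (fun s : ℝ ↦ s • ω) ω (Icc p q) s := by
    simpa using ((hasDerivAt_id s).smul_const ω).hasDerivWithinAt
  exact (hf _ (hK s hs)).comp_hasDerivWithinAt s h1 hK

section

variable {d : ℕ} {a b : ℝ} {E : EuclideanSpace ℝ (Fin d) → ℝ}

lemma exists_norm_eq_smul {x : EuclideanSpace ℝ (Fin d)} (hx : 0 < ‖x‖) :
    ∃ ω : EuclideanSpace ℝ (Fin d), ‖ω‖ = 1 ∧ ‖x‖ • ω = x := by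
  refine ⟨‖x‖⁻¹ • x, ?_, ?_⟩
  · rw [norm_smul, norm_inv, norm_norm, inv_mul_cancel₀ hx.ne']
  · rw [smul_smul, mul_inv_cancel₀ hx.ne', one_smul]

lemma norm_smul_of_norm_eq_one {ω : EuclideanSpace ℝ (Fin d)} (hω : ‖ω‖ = 1) {s : ℝ}
    (hs : 0 ≤ s) : ‖s • ω‖ = s := by
  rw [norm_smul, hω, mul_one, Real.norm_of_nonneg hs]

lemma abs_le_min_of_norm_fderivWithin_le {r R M : ℝ} (ha : 0 < a) (har : a ≤ r) (hRb : R ≤ b)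
    (hE : DifferentiableOn ℝ E (closedAnnulus d a b))
    (hM : ∀ x ∈ closedAnnulus d a b, ‖fderivWithin ℝ E (closedAnnulus d a b) x‖ ≤ M)
    (hr0 : ∀ x, ‖x‖ = r → E x = 0) (hR0 : ∀ x, ‖x‖ = R → E x = 0)
    {x : EuclideanSpace ℝ (Fin d)} (hx : x ∈ annulus d r R) :
    |E x| ≤ M * min (‖x‖ - r) (R - ‖x‖) := by
  have hx0 : 0 < ‖x‖ := (ha.trans_le har).trans hx.1
  obtain ⟨ω, hω, hxω⟩ := exists_norm_eq_smul hx0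
  have hn : ∀ s ∈ Icc r R, ‖s • ω‖ = s := fun s hs ↦
    norm_smul_of_norm_eq_one hω ((ha.le.trans har).trans hs.1)
  have hK : ∀ s ∈ Icc r R, s • ω ∈ closedAnnulus d a b := fun s hs ↦ by
    refine ⟨?_, ?_⟩ <;> rw [hn s hs]
    exacts [har.trans hs.1, hs.2.trans hRb]
  have hrR : r ≤ R := (hx.1.trans hx.2).le
  have key := fun {s t : ℝ} ↦ norm_sub_le_of_ray (C := M) (s := s) (t := t) hK
    (fun y hy ↦ (hE y hy).hasFDerivWithinAt) fun s hs ↦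
      ((fderivWithin ℝ E (closedAnnulus d a b) (s • ω)).le_opNorm ω).trans (by
        rw [hω, mul_one]; exact hM _ (hK s hs))
  have hxI : ‖x‖ ∈ Icc r R := ⟨hx.1.le, hx.2.le⟩
  have h1 := key (left_mem_Icc.2 hrR) hxI
  have h2 := key (right_mem_Icc.2 hrR) hxI
  rw [hxω, hr0 _ (hn r (left_mem_Icc.2 hrR)), sub_zero, abs_of_pos (by linarith [hx.1])] at h1
  rw [hxω, hR0 _ (hn R (right_mem_Icc.2 hrR)), sub_zero, abs_sub_comm,
    abs_of_pos (by linarith [hx.2])] at h2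
  rcases min_choice (‖x‖ - r) (R - ‖x‖) with h | h <;> rw [h]
  exacts [h1, h2]

lemma exists_bound_fderivWithin (ha : 0 < a) (hab : a < b)
    (hE : ContDiffOn ℝ 1 E (closedAnnulus d a b)) :
    ∃ M : ℝ, 0 ≤ M ∧ ∀ x ∈ closedAnnulus d a b,
      ‖fderivWithin ℝ E (closedAnnulus d a b) x‖ ≤ M := by
  obtain ⟨M, hM⟩ := (isCompact_closedAnnulus d a b).exists_bound_of_continuousOn
    (hE.continuousOn_fderivWithin (uniqueDiffOn_closedAnnulus d ha hab) le_rfl)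
  exact ⟨|M|, abs_nonneg _, fun x hx ↦ (hM x hx).trans (le_abs_self M)⟩

/-- A `C²` function on a closed annulus with vanishing Cauchy data on the boundary is of second
order at the boundary, and its radial derivative is of first order. -/
lemma exists_bound_of_boundary_eq_zero (ha : 0 < a) (hab : a < b)
    (hE : ContDiffOn ℝ 2 E (closedAnnulus d a b))
    (hE0 : ∀ x, ‖x‖ = a ∨ ‖x‖ = b → E x = 0)
    (hE1 : ∀ x, ‖x‖ = a ∨ ‖x‖ = b → fderivWithin ℝ E (closedAnnulus d a b) x x = 0) :
    ∃ M : ℝ, ∀ x ∈ annulus d a b, |E x| ≤ M * min (‖x‖ - a) (b - ‖x‖) ^ 2 ∧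
      |fderiv ℝ E x x / ‖x‖| ≤ M * min (‖x‖ - a) (b - ‖x‖) := by
  set K := closedAnnulus d a b with hKdef
  have hU := uniqueDiffOn_closedAnnulus d ha hab
  set DE := fderivWithin ℝ E K with hDE
  have hD1 : ContDiffOn ℝ 1 DE K := hE.fderivWithin hU (by norm_num)
  have hdE : DifferentiableOn ℝ E K := hE.differentiableOn two_ne_zero
  have hdD : DifferentiableOn ℝ DE K := hD1.differentiableOn one_ne_zero
  obtain ⟨M, hM⟩ := (isCompact_closedAnnulus d a b).exists_bound_of_continuousOn
    (hD1.continuousOn_fderivWithin hU le_rfl)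
  refine ⟨M, fun x hx ↦ ?_⟩
  have hx0 : 0 < ‖x‖ := ha.trans hx.1
  obtain ⟨ω, hω, hxω⟩ := exists_norm_eq_smul hx0
  have hn : ∀ s ∈ Icc a b, ‖s • ω‖ = s := fun s hs ↦
    norm_smul_of_norm_eq_one hω (ha.le.trans hs.1)
  have hK : ∀ s ∈ Icc a b, s • ω ∈ K := fun s hs ↦ by
    refine ⟨?_, ?_⟩ <;> rw [hn s hs]
    exacts [hs.1, hs.2]
  have haI : a ∈ Icc a b := left_mem_Icc.2 hab.le
  have hbI : b ∈ Icc a b := right_mem_Icc.2 hab.le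
  have hM0 : 0 ≤ M := (norm_nonneg _).trans (hM _ (hK a haI))
  have hzero : ∀ s ∈ Icc a b, s = a ∨ s = b → DE (s • ω) ω = 0 := by
    intro s hs h
    have h0 := hE1 (s • ω) (by rwa [hn s hs])
    rw [map_smul, smul_eq_mul] at h0
    exact (mul_eq_zero.1 h0).resolve_left (ha.trans_le hs.1).ne'
  have hD : ∀ s ∈ Icc a b, ∀ t ∈ Icc a b, t = a ∨ t = b → ‖DE (s • ω) ω‖ ≤ M * |s - t| := by
    intro s hs t ht h
    have key := norm_sub_le_of_ray (C := M) (s := t) (t := s) hK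
      (fun y hy ↦ (hdD y hy).hasFDerivWithinAt) (fun s hs ↦
        ((fderivWithin ℝ DE K (s • ω)).le_opNorm ω).trans (by
          rw [hω, mul_one]; exact hM _ (hK s hs))) ht hs
    have h2 := ((DE (s • ω) - DE (t • ω)).le_opNorm ω).trans
      (mul_le_mul_of_nonneg_right key (norm_nonneg ω))
    simpa [hω, hzero t ht h] using h2
  have hxI : ‖x‖ ∈ Icc a b := ⟨hx.1.le, hx.2.le⟩
  have hax : |‖x‖ - a| = ‖x‖ - a := abs_of_pos (by linarith [hx.1])
  have hbx : |‖x‖ - b| = b - ‖x‖ := by rw [abs_sub_comm, abs_of_pos (by linarith [hx.2])]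
  have hP : fderiv ℝ E x x / ‖x‖ = DE (‖x‖ • ω) ω := by
    rw [hxω, hDE, fderivWithin_of_mem_nhds (closedAnnulus_mem_nhds hx), div_eq_iff hx0.ne']
    conv_lhs => rw [← hxω, map_smul, smul_eq_mul, hxω, mul_comm]
  have h1 : |E x| ≤ M * (‖x‖ - a) ^ 2 := by
    have key := norm_sub_le_of_ray (p := a) (q := ‖x‖) (C := M * (‖x‖ - a)) (s := a) (t := ‖x‖)
      (fun s hs ↦ hK s ⟨hs.1, hs.2.trans hx.2.le⟩) (fun y hy ↦ (hdE y hy).hasFDerivWithinAt)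
      (fun s hs ↦ (hD s ⟨hs.1, hs.2.trans hx.2.le⟩ a haI (Or.inl rfl)).trans (by
        rw [abs_of_nonneg (sub_nonneg.2 hs.1)]
        gcongr
        exact hs.2)) (left_mem_Icc.2 hx.1.le) (right_mem_Icc.2 hx.1.le)
    rw [hxω, hE0 (a • ω) (Or.inl (hn a haI)), sub_zero, hax, Real.norm_eq_abs] at key
    linarith
  have h2 : |E x| ≤ M * (b - ‖x‖) ^ 2 := by
    have key := norm_sub_le_of_ray (p := ‖x‖) (q := b) (C := M * (b - ‖x‖)) (s := b) (t := ‖x‖)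
      (fun s hs ↦ hK s ⟨hx.1.le.trans hs.1, hs.2⟩) (fun y hy ↦ (hdE y hy).hasFDerivWithinAt)
      (fun s hs ↦ (hD s ⟨hx.1.le.trans hs.1, hs.2⟩ b hbI (Or.inr rfl)).trans (by
        rw [abs_sub_comm, abs_of_nonneg (sub_nonneg.2 hs.2)]
        gcongr
        exact hs.1)) (right_mem_Icc.2 hx.2.le) (left_mem_Icc.2 hx.2.le)
    rw [hxω, hE0 (b • ω) (Or.inr (hn b hbI)), sub_zero, hbx, Real.norm_eq_abs] at key
    linarith
  have h3 := hD ‖x‖ hxI a haI (Or.inl rfl)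
  have h4 := hD ‖x‖ hxI b hbI (Or.inr rfl)
  rw [hax] at h3
  rw [hbx] at h4
  rw [hP]
  rcases min_choice (‖x‖ - a) (b - ‖x‖) with h | h <;> rw [h]
  exacts [⟨h1, h3⟩, ⟨h2, h4⟩]

end

/-- The Laplace operator computed with derivatives within a set. -/
def laplacianWithin {d : ℕ} (K : Set (EuclideanSpace ℝ (Fin d)))
    (f : EuclideanSpace ℝ (Fin d) → ℝ) (x : EuclideanSpace ℝ (Fin d)) : ℝ :=
  ∑ i, fderivWithin ℝ (fun y ↦ fderivWithin ℝ f K y (EuclideanSpace.single i 1)) K x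
    (EuclideanSpace.single i 1)

lemma contDiffOn_laplacianWithin {d : ℕ} {K : Set (EuclideanSpace ℝ (Fin d))}
    (hK : UniqueDiffOn ℝ K) {f : EuclideanSpace ℝ (Fin d) → ℝ} {m n : WithTop ℕ∞}
    (hf : ContDiffOn ℝ n f K) (hmn : m + 1 + 1 ≤ n) : ContDiffOn ℝ m (laplacianWithin K f) K := by
  refine ContDiffOn.sum fun i _ ↦ ?_
  have h1 : ContDiffOn ℝ (m + 1) (fun y ↦ fderivWithin ℝ f K y (EuclideanSpace.single i 1)) K :=
    (hf.fderivWithin hK hmn).clm_apply contDiffOn_const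
  exact (h1.fderivWithin hK le_rfl).clm_apply contDiffOn_const

lemma laplacian_congr {d : ℕ} {f g : EuclideanSpace ℝ (Fin d) → ℝ}
    {x : EuclideanSpace ℝ (Fin d)} (h : f =ᶠ[𝓝 x] g) : laplacian f x = laplacian g x := by
  unfold laplacian
  rw [(h.iteratedFDeriv ℝ 2).eq_of_nhds]

lemma laplacianWithin_eq_laplacian {d : ℕ} {K : Set (EuclideanSpace ℝ (Fin d))}
    {f : EuclideanSpace ℝ (Fin d) → ℝ} (hf : ContDiffOn ℝ 2 f K)
    {x : EuclideanSpace ℝ (Fin d)} (hx : K ∈ 𝓝 x) : laplacianWithin K f x = laplacian f x := by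
  rw [laplacian_eq_sum_fderiv (hf.contDiffAt hx)]
  refine Finset.sum_congr rfl fun i _ ↦ ?_
  rw [fderivWithin_of_mem_nhds hx]
  congr 1
  refine Filter.EventuallyEq.fderiv_eq ?_
  filter_upwards [eventually_mem_nhds_iff.2 hx] with y hy
  rw [fderivWithin_of_mem_nhds hy]

lemma contDiffOn_laplacian {d : ℕ} {Ω : Set (EuclideanSpace ℝ (Fin d))} (hΩ : IsOpen Ω)
    {f : EuclideanSpace ℝ (Fin d) → ℝ} {m : WithTop ℕ∞} {n : WithTop ℕ∞}
    (hf : ContDiffOn ℝ n f Ω) (hmn : m + 1 + 1 ≤ n) : ContDiffOn ℝ m (laplacian f) Ω := by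
  refine (contDiffOn_laplacianWithin hΩ.uniqueDiffOn hf hmn).congr fun x hx ↦ ?_
  refine (laplacianWithin_eq_laplacian (hf.of_le (le_trans ?_ hmn)) (hΩ.mem_nhds hx)).symm
  rw [add_assoc, one_add_one_eq_two]
  exact le_add_self

lemma laplacian_sub {d : ℕ} {f g : EuclideanSpace ℝ (Fin d) → ℝ}
    {x : EuclideanSpace ℝ (Fin d)} (hf : ContDiffAt ℝ 2 f x) (hg : ContDiffAt ℝ 2 g x) :
    laplacian (fun y ↦ f y - g y) x = laplacian f x - laplacian g x := by
  have : iteratedFDeriv ℝ 2 (fun y ↦ f y - g y) x =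
      iteratedFDeriv ℝ 2 f x - iteratedFDeriv ℝ 2 g x := iteratedFDeriv_sub_apply hf hg
  simp only [laplacian, this, sub_apply, Finset.sum_sub_distrib]

section

variable {d n : ℕ} {r : Fin (n + 1) → ℝ}

lemma annulus_subset_annulus (hr : StrictMono r) (i : Fin n) :
    annulus d (r i.castSucc) (r i.succ) ⊆ annulus d (r 0) (r (Fin.last n)) := fun _ hx ↦
  ⟨(hr.monotone (Fin.zero_le _)).trans_lt hx.1, hx.2.trans_le (hr.monotone (Fin.le_last _))⟩

lemma annulus_subset_closedAnnulus {a b : ℝ} : annulus d a b ⊆ closedAnnulus d a b :=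
  fun _ hx ↦ ⟨hx.1.le, hx.2.le⟩

lemma exists_mem_annulus_or_norm_eq {x : EuclideanSpace ℝ (Fin d)}
    (hx : x ∈ annulus d (r 0) (r (Fin.last n))) :
    (∃ i : Fin n, x ∈ annulus d (r i.castSucc) (r i.succ)) ∨ ∃ i, ‖x‖ = r i := by
  by_contra! hcon
  have : ∀ i, r i < ‖x‖ := by
    intro i
    induction i using Fin.induction with
    | zero => exact hx.1
    | succ i ih =>
      by_contra hlt
      exact hcon.1 i ⟨ih, lt_of_le_of_ne (not_lt.1 hlt) (hcon.2 i.succ)⟩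
  exact lt_asymm (this _) hx.2

lemma disjoint_annulus (hr : StrictMono r) {i j : Fin n} (hij : i < j) :
    Disjoint (annulus d (r i.castSucc) (r i.succ)) (annulus d (r j.castSucc) (r j.succ)) := by
  refine Set.disjoint_left.2 fun x hx hx' ↦ ?_
  have : r i.succ ≤ r j.castSucc := hr.monotone (Fin.le_def.2 (by simpa using hij))
  exact absurd (hx.2.trans_le this) (not_lt.2 hx'.1.le)

/-- The integral over an annulus is the sum of the integrals over concentric subannuli. -/
lemma integral_annulus_eq_sum (hr0 : 0 < r 0) (hr : StrictMono r)
    {f : EuclideanSpace ℝ (Fin d) → ℝ} (hf : IntegrableOn f (annulus d (r 0) (r (Fin.last n)))) :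
    ∫ x in annulus d (r 0) (r (Fin.last n)), f x =
      ∑ i : Fin n, ∫ x in annulus d (r i.castSucc) (r i.succ), f x := by
  rw [← integral_iUnion_fintype]
  · refine setIntegral_congr_set (Filter.EventuallyEq.symm ?_)
    refine ae_eq_set.2 ⟨?_, ?_⟩
    · rw [sdiff_eq_empty.2 (iUnion_subset fun i ↦ annulus_subset_annulus hr i), measure_empty]
    · refine measure_mono_null (t := ⋃ i, sphere 0 (r i)) (fun x hx ↦ ?_) ?_
      · rcases exists_mem_annulus_or_norm_eq hx.1 with ⟨i, hi⟩ | ⟨i, hi⟩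
        · exact absurd (mem_iUnion.2 ⟨i, hi⟩) hx.2
        · exact mem_iUnion.2 ⟨i, by simpa using hi⟩
      · exact measure_iUnion_null fun i ↦ Measure.addHaar_sphere_of_ne_zero _ _
          (hr0.trans_le (hr.monotone (Fin.zero_le _))).ne'
  · exact fun i ↦ (isOpen_annulus d _ _).measurableSet
  · intro i j hij
    rcases lt_or_gt_of_ne hij with h | h
    · exact disjoint_annulus hr h
    · exact (disjoint_annulus hr h).symm
  · exact fun i ↦ hf.mono_set (annulus_subset_annulus hr i)

end

lemma integrableOn_annulus {d : ℕ} {a b r R : ℝ} {f g : EuclideanSpace ℝ (Fin d) → ℝ}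
    (hg : ContinuousOn g (closedAnnulus d a b)) (hsub : annulus d r R ⊆ closedAnnulus d a b)
    (hfg : EqOn g f (annulus d r R)) : IntegrableOn f (annulus d r R) :=
  ((hg.integrableOn_compact (isCompact_closedAnnulus d a b)).mono_set hsub).congr_fun hfg
    (isOpen_annulus d r R).measurableSet

lemma integral_sq_le_of_poincare {X : Type*} [MeasurableSpace X] {μ : Measure X} {f g : X → ℝ}
    {k : ℝ} (hf : Integrable (fun x ↦ f x ^ 2) μ) (hg : Integrable (fun x ↦ g x ^ 2) μ)
    (hfg : Integrable (fun x ↦ f x * g x) μ)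
    (h : ∫ x, f x ^ 2 ∂μ ≤ k * -∫ x, f x * g x ∂μ) :
    ∫ x, f x ^ 2 ∂μ ≤ k ^ 2 * ∫ x, g x ^ 2 ∂μ := by
  have h2 : 0 ≤ ∫ x, (f x ^ 2 + k ^ 2 * g x ^ 2 + 2 * k * (f x * g x)) ∂μ :=
    integral_nonneg fun x ↦ by
      have := sq_nonneg (f x + k * g x)
      simp only [Pi.zero_apply]
      linarith
  have hA : Integrable (fun x ↦ f x ^ 2 + k ^ 2 * g x ^ 2) μ := hf.add (hg.const_mul _)
  rw [integral_add hA (hfg.const_mul _), integral_add hf (hg.const_mul _),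
    integral_const_mul, integral_const_mul] at h2
  linarith

/-- Approximation of continuous functions on a closed annulus by smooth functions. -/
lemma exists_contDiff_abs_sub_le {d : ℕ} {a b : ℝ} {U : EuclideanSpace ℝ (Fin d) → ℝ}
    (hU : ContinuousOn U (closedAnnulus d a b)) {η : ℝ} (hη : 0 < η) :
    ∃ V : EuclideanSpace ℝ (Fin d) → ℝ, ContDiff ℝ 4 V ∧
      ∀ x ∈ closedAnnulus d a b, |U x - V x| ≤ η := by
  obtain ⟨g, hg⟩ := ContinuousMap.exists_restrict_eq (isCompact_closedAnnulus d a b).isClosed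
    ⟨(closedAnnulus d a b).domRestrict U, hU.domRestrict⟩
  obtain ⟨V, hV, hVg, -⟩ := g.continuous.exists_contDiff_approx 4 (ε := fun _ ↦ η)
    continuous_const fun _ ↦ hη
  refine ⟨V, hV, fun x hx ↦ ?_⟩
  have hgx : g x = U x := congrArg (fun h ↦ h ⟨x, hx⟩) hg
  have := (hVg x).le
  rw [Real.dist_eq, hgx, abs_sub_comm] at this
  exact this

section

variable {d n : ℕ} {r : Fin (n + 1) → ℝ} {E G : EuclideanSpace ℝ (Fin d) → ℝ}

/-- Green's formula for a function which is piecewise `C⁴` on a partition of an annulus by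
concentric annuli, has vanishing Cauchy data on the boundary and vanishes on the interfaces. -/
lemma integral_laplacian_sq_eq (hn : 1 ≤ n) (hr0 : 0 < r 0) (hr : StrictMono r)
    (hE : ContDiffOn ℝ 2 E (closedAnnulus d (r 0) (r (Fin.last n))))
    (hE4 : ∀ i : Fin n, ContDiffOn ℝ 4 E (annulus d (r i.castSucc) (r i.succ)))
    (hE0 : ∀ (i : Fin (n + 1)) (x : EuclideanSpace ℝ (Fin d)), ‖x‖ = r i → E x = 0)
    (hE1 : ∀ x : EuclideanSpace ℝ (Fin d), (‖x‖ = r 0 ∨ ‖x‖ = r (Fin.last n)) →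
      fderivWithin ℝ E (closedAnnulus d (r 0) (r (Fin.last n))) x x = 0)
    (hG : ContinuousOn G (closedAnnulus d (r 0) (r (Fin.last n))))
    (hEG : ∀ i : Fin n, ∀ x ∈ annulus d (r i.castSucc) (r i.succ),
      laplacian (laplacian E) x = G x) :
    ∫ x in annulus d (r 0) (r (Fin.last n)), laplacian E x ^ 2 =
      ∫ x in annulus d (r 0) (r (Fin.last n)), E x * G x := by
  have hab : r 0 < r (Fin.last n) := hr (Fin.lt_def.2 (by simp; omega))
  set K := closedAnnulus d (r 0) (r (Fin.last n)) with hK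
  set Ω := annulus d (r 0) (r (Fin.last n)) with hΩ
  have hΩo : IsOpen Ω := isOpen_annulus d _ _
  have hΩK : Ω ⊆ K := annulus_subset_closedAnnulus
  have huniq : UniqueDiffOn ℝ K := uniqueDiffOn_closedAnnulus d hr0 hab
  set U := laplacianWithin K E with hUdef
  have hU : ContinuousOn U K :=
    (contDiffOn_laplacianWithin (m := 0) huniq hE (by norm_num [one_add_one_eq_two])).continuousOn
  have hUE : EqOn U (laplacian E) Ω := fun x hx ↦
    laplacianWithin_eq_laplacian hE (closedAnnulus_mem_nhds hx)
  have hsub : ∀ i : Fin n, annulus d (r i.castSucc) (r i.succ) ⊆ Ω :=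
    fun i ↦ annulus_subset_annulus hr i
  have hiu : ∀ i : Fin n, r i.castSucc < r i.succ := fun i ↦ hr (Fin.castSucc_lt_succ)
  have hipos : ∀ i, 0 < r i := fun i ↦ hr0.trans_le (hr.monotone (Fin.zero_le _))
  have hEΩ : ContDiffOn ℝ 2 E Ω := hE.mono hΩK
  obtain ⟨M, hM0, hM⟩ := exists_bound_fderivWithin hr0 hab (hE.of_le (by norm_num))
  obtain ⟨M', hM'⟩ := exists_bound_of_boundary_eq_zero hr0 hab hE
    (fun x hx ↦ hx.elim (hE0 _ x) (hE0 _ x)) hE1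
  have hLE : ∀ i : Fin n, ContDiffOn ℝ 2 (laplacian E) (annulus d (r i.castSucc) (r i.succ)) :=
    fun i ↦ contDiffOn_laplacian (isOpen_annulus d _ _) (hE4 i) (by norm_num)
  have hInt : IntegrableOn (fun x ↦ laplacian E x ^ 2 - E x * G x) Ω :=
    integrableOn_annulus ((hU.pow 2).sub (hE.continuousOn.mul hG)) hΩK fun x hx ↦ by simp [hUE hx]
  choose C hC0 hC using fun i : Fin n ↦ abs_integral_green_le d (M := M) (hipos i.castSucc) (hiu i)
  suffices h : ∫ x in Ω, (laplacian E x ^ 2 - E x * G x) = 0 by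
    rw [integral_sub] at h
    · linarith
    · exact integrableOn_annulus (hU.pow 2) hΩK fun x hx ↦ by simp [hUE hx]
    · exact integrableOn_annulus (hE.continuousOn.mul hG) hΩK fun x hx ↦ rfl
  have hbound : ∀ η : ℝ, 0 < η →
      |∫ x in Ω, (laplacian E x ^ 2 - E x * G x)| ≤ (∑ i, C i) * η := by
    intro η hη
    obtain ⟨V, hV, hVU⟩ := exists_contDiff_abs_sub_le hU hη
    have hV2 : ContDiff ℝ 2 V := hV.of_le (by norm_num)
    have hLV : ContinuousOn (laplacian V) K :=
      (contDiffOn_laplacian (m := 0) isOpen_univ hV.contDiffOn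
        (by norm_num [one_add_one_eq_two])).continuousOn.mono (subset_univ _)
    have hVint : IntegrableOn (fun x ↦ V x * laplacian E x - E x * laplacian V x) Ω :=
      integrableOn_annulus ((hV.continuous.continuousOn.mul hU).sub (hE.continuousOn.mul hLV)) hΩK
        fun x hx ↦ by simp [hUE hx]
    obtain ⟨η', hη'⟩ :=
      (isCompact_closedAnnulus d (r 0) (r (Fin.last n))).exists_bound_of_continuousOn
        hV.continuous.continuousOn
    have hzero : ∫ x in Ω, (V x * laplacian E x - E x * laplacian V x) = 0 :=
      integral_green_eq_zero_of_boundary hr0 hab hEΩ hV2.contDiffOn hVint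
        (fun x hx ↦ (hM' x hx).1) (fun x hx ↦ (hM' x hx).2) fun x hx ↦ hη' x (hΩK hx)
    set g : EuclideanSpace ℝ (Fin d) → ℝ := fun x ↦ (laplacian E x ^ 2 - E x * G x) -
      (V x * laplacian E x - E x * laplacian V x) with hg
    have hgint : IntegrableOn g Ω := hInt.sub hVint
    have heq : ∫ x in Ω, (laplacian E x ^ 2 - E x * G x) = ∫ x in Ω, g x := by
      rw [hg, integral_sub hInt hVint, hzero, sub_zero]
    rw [heq, integral_annulus_eq_sum hr0 hr hgint, Finset.sum_mul]
    refine (Finset.abs_sum_le_sum_abs _ _).trans (Finset.sum_le_sum fun i _ ↦ ?_)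
    have hΩi := isOpen_annulus d (r i.castSucc) (r i.succ)
    have hcongr : EqOn g (fun x ↦ (laplacian E x - V x) * laplacian E x -
        E x * laplacian (fun y ↦ laplacian E y - V y) x)
        (annulus d (r i.castSucc) (r i.succ)) := by
      intro x hx
      simp only [hg]
      rw [laplacian_sub ((hLE i).contDiffAt (hΩi.mem_nhds hx)) hV2.contDiffAt, hEG i x hx]
      ring
    rw [setIntegral_congr_fun hΩi.measurableSet hcongr]
    refine hC i E (fun x ↦ laplacian E x - V x) η hη.le (hEΩ.mono (hsub i))
      ((hLE i).sub hV2.contDiffOn)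
      ((hgint.mono_set (hsub i)).congr_fun hcongr hΩi.measurableSet) ?_ ?_ ?_
    · exact fun x hx ↦ abs_le_min_of_norm_fderivWithin_le hr0 (hr.monotone (Fin.zero_le _))
        (hr.monotone (Fin.le_last _)) (hE.differentiableOn two_ne_zero) hM (hE0 _) (hE0 _) hx
    · intro x hx
      have hx0 : 0 < ‖x‖ := (hipos _).trans hx.1
      rw [← fderivWithin_of_mem_nhds (closedAnnulus_mem_nhds (hsub i hx)), abs_div, abs_norm,
        div_le_iff₀ hx0]
      exact (ContinuousLinearMap.le_opNorm _ _).trans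
        (mul_le_mul_of_nonneg_right (hM x (hΩK (hsub i hx))) (norm_nonneg _))
    · intro x hx
      rw [← hUE (hsub i hx)]
      exact hVU x (hΩK (hsub i hx))
  have hlim : Tendsto (fun η : ℝ ↦ (∑ i, C i) * η) (𝓝[>] 0) (𝓝 ((∑ i, C i) * 0)) :=
    Tendsto.mono_left (Continuous.tendsto (by fun_prop) 0) nhdsWithin_le_nhds
  rw [mul_zero] at hlim
  refine abs_nonpos_iff.1 (ge_of_tendsto hlim ?_)
  filter_upwards [self_mem_nhdsWithin] with η hη using hbound η hη

/-- Poincaré type inequality for functions vanishing on the interfaces of a partition of an annulus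
by concentric annuli. -/
lemma integral_sq_le_integral_laplacian_sq (hd : 2 ≤ d) (hn : 1 ≤ n) (hr0 : 0 < r 0)
    (hr : StrictMono r)
    (hE : ContDiffOn ℝ 2 E (closedAnnulus d (r 0) (r (Fin.last n))))
    (hE0 : ∀ (i : Fin (n + 1)) (x : EuclideanSpace ℝ (Fin d)), ‖x‖ = r i → E x = 0) :
    ∫ x in annulus d (r 0) (r (Fin.last n)), E x ^ 2 ≤
      max (1 / (2 * (d : ℝ))) (1 / 8) ^ 2 * (⨆ i : Fin n, (r i.succ - r i.castSucc) ^ 4) *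
        ∫ x in annulus d (r 0) (r (Fin.last n)), laplacian E x ^ 2 := by
  have hab : r 0 < r (Fin.last n) := hr (Fin.lt_def.2 (by simp; omega))
  set K := closedAnnulus d (r 0) (r (Fin.last n)) with hK
  set Ω := annulus d (r 0) (r (Fin.last n)) with hΩ
  have hΩK : Ω ⊆ K := annulus_subset_closedAnnulus
  have huniq : UniqueDiffOn ℝ K := uniqueDiffOn_closedAnnulus d hr0 hab
  have hU : ContinuousOn (laplacianWithin K E) K :=
    (contDiffOn_laplacianWithin (m := 0) huniq hE (by norm_num [one_add_one_eq_two])).continuousOn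
  have hUE : EqOn (laplacianWithin K E) (laplacian E) Ω := fun x hx ↦
    laplacianWithin_eq_laplacian hE (closedAnnulus_mem_nhds hx)
  have hsub : ∀ i : Fin n, annulus d (r i.castSucc) (r i.succ) ⊆ Ω :=
    fun i ↦ annulus_subset_annulus hr i
  have hipos : ∀ i, 0 < r i := fun i ↦ hr0.trans_le (hr.monotone (Fin.zero_le _))
  obtain ⟨M, hM0, hM⟩ := exists_bound_fderivWithin hr0 hab (hE.of_le (by norm_num))
  have hi1 : IntegrableOn (fun x ↦ E x ^ 2) Ω :=
    integrableOn_annulus (hE.continuousOn.pow 2) hΩK fun x _ ↦ rfl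
  have hi2 : IntegrableOn (fun x ↦ laplacian E x ^ 2) Ω :=
    integrableOn_annulus (hU.pow 2) hΩK fun x hx ↦ by simp [hUE hx]
  have hi3 : IntegrableOn (fun x ↦ E x * laplacian E x) Ω :=
    integrableOn_annulus (hE.continuousOn.mul hU) hΩK fun x hx ↦ by simp [hUE hx]
  rw [integral_annulus_eq_sum hr0 hr hi1, integral_annulus_eq_sum hr0 hr hi2, Finset.mul_sum]
  refine Finset.sum_le_sum fun i _ ↦ ?_
  have hbdd : BddAbove (range fun i : Fin n ↦ (r i.succ - r i.castSucc) ^ 4) :=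
    (finite_range _).bddAbove
  have hP := poincare_annulus (M := M) hd (hipos i.castSucc) (hr Fin.castSucc_lt_succ)
    ((hE.mono hΩK).mono (hsub i))
    (fun x hx ↦ abs_le_min_of_norm_fderivWithin_le hr0 (hr.monotone (Fin.zero_le _))
        (hr.monotone (Fin.le_last _)) (hE.differentiableOn two_ne_zero) hM (hE0 _) (hE0 _) hx)
    (fun x hx ↦ by
      have hx0 : 0 < ‖x‖ := (hipos _).trans hx.1
      rw [← fderivWithin_of_mem_nhds (closedAnnulus_mem_nhds (hsub i hx)), abs_div, abs_norm,
        div_le_iff₀ hx0]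
      exact (ContinuousLinearMap.le_opNorm _ _).trans
        (mul_le_mul_of_nonneg_right (hM x (hΩK (hsub i hx))) (norm_nonneg _)))
    (hi1.mono_set (hsub i)) (hi3.mono_set (hsub i))
  refine (integral_sq_le_of_poincare (hi1.mono_set (hsub i)) (hi2.mono_set (hsub i))
    (hi3.mono_set (hsub i)) hP).trans ?_
  refine mul_le_mul_of_nonneg_right ?_ (integral_nonneg fun x ↦ sq_nonneg _)
  rw [mul_pow, ← pow_mul]
  exact mul_le_mul_of_nonneg_left (le_ciSup hbdd i) (sq_nonneg _)

end

/-- `L²` error estimate for interpolation by biharmonic splines on an annulus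
with concentric annular partition, with natural boundary conditions. -/
theorem biharmonic_spline_L2_error
    (d n : ℕ) (hd : 2 ≤ d) (hn : 1 ≤ n) (r : Fin (n + 1) → ℝ)
    (hr0 : 0 < r 0) (hr : StrictMono r)
    (F S : EuclideanSpace ℝ (Fin d) → ℝ)
    (hF : ContDiffOn ℝ 4 F (closedAnnulus d (r 0) (r (Fin.last n))))
    (hS : BiharmonicSpline d n r S)
    (hinterp : ∀ (i : Fin (n + 1)) (x : EuclideanSpace ℝ (Fin d)), ‖x‖ = r i → S x = F x)
    (hnormal : ∀ x : EuclideanSpace ℝ (Fin d), (‖x‖ = r 0 ∨ ‖x‖ = r (Fin.last n)) →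
      fderivWithin ℝ S (closedAnnulus d (r 0) (r (Fin.last n))) x x =
      fderivWithin ℝ F (closedAnnulus d (r 0) (r (Fin.last n))) x x) :
    Real.sqrt (∫ x in annulus d (r 0) (r (Fin.last n)), (F x - S x) ^ 2) ≤
      (max (1 / (2 * (d : ℝ))) (1 / 8)) ^ 2 *
        (⨆ i : Fin n, (r i.succ - r i.castSucc) ^ 4) *
        Real.sqrt (∫ x in annulus d (r 0) (r (Fin.last n)),
          (laplacian (laplacian F) x) ^ 2) := by
  have hab : r 0 < r (Fin.last n) := hr (Fin.lt_def.2 (by simp; omega))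
  set K := closedAnnulus d (r 0) (r (Fin.last n)) with hK
  set Ω := annulus d (r 0) (r (Fin.last n)) with hΩ
  set k : ℝ := max (1 / (2 * (d : ℝ))) (1 / 8) ^ 2 *
    ⨆ i : Fin n, (r i.succ - r i.castSucc) ^ 4 with hk
  obtain ⟨hS2, hS4⟩ := hS
  have hΩo : IsOpen Ω := isOpen_annulus d _ _
  have hΩK : Ω ⊆ K := annulus_subset_closedAnnulus
  have huniq : UniqueDiffOn ℝ K := uniqueDiffOn_closedAnnulus d hr0 hab
  have hF2 : ContDiffOn ℝ 2 F K := hF.of_le (by norm_num)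
  have hE : ContDiffOn ℝ 2 (fun x ↦ F x - S x) K := hF2.sub hS2
  have hsub : ∀ i : Fin n, annulus d (r i.castSucc) (r i.succ) ⊆ Ω :=
    fun i ↦ annulus_subset_annulus hr i
  have hLF : ContDiffOn ℝ 2 (laplacianWithin K F) K :=
    contDiffOn_laplacianWithin huniq hF (by norm_num)
  have hG : ContinuousOn (laplacianWithin K (laplacianWithin K F)) K :=
    (contDiffOn_laplacianWithin (m := 0) huniq hLF (by norm_num [one_add_one_eq_two])).continuousOn
  have hLFeq : EqOn (laplacianWithin K F) (laplacian F) Ω := fun x hx ↦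
    laplacianWithin_eq_laplacian hF2 (closedAnnulus_mem_nhds hx)
  have hGF : EqOn (laplacianWithin K (laplacianWithin K F)) (laplacian (laplacian F)) Ω :=
    fun x hx ↦ (laplacianWithin_eq_laplacian hLF (closedAnnulus_mem_nhds hx)).trans
      (laplacian_congr (hLFeq.eventuallyEq_of_mem (hΩo.mem_nhds hx)))
  have hE0 : ∀ (i : Fin (n + 1)) (x : EuclideanSpace ℝ (Fin d)), ‖x‖ = r i → F x - S x = 0 :=
    fun i x hx ↦ by rw [hinterp i x hx, sub_self]
  have hgreen := integral_laplacian_sq_eq (G := laplacianWithin K (laplacianWithin K F))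
    hn hr0 hr hE (fun i ↦ (hF.mono ((hsub i).trans hΩK)).sub (hS4 i).1) hE0
    (fun x hx ↦ by
      have hxK : x ∈ K := by
        rcases hx with h | h
        · exact ⟨h.ge, h.trans_le hab.le⟩
        · exact ⟨hab.le.trans h.ge, h.le⟩
      have h1 := hF2.differentiableOn two_ne_zero x hxK
      have h2 := hS2.differentiableOn two_ne_zero x hxK
      have h3 : HasFDerivWithinAt (fun x ↦ F x - S x) _ K x :=
        h1.hasFDerivWithinAt.sub h2.hasFDerivWithinAt
      change fderivWithin ℝ (fun x ↦ F x - S x) K x x = 0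
      rw [h3.fderivWithin (huniq x hxK)]
      exact sub_eq_zero.2 (hnormal x hx).symm) hG
    (fun i x hx ↦ by
      have hΩi := isOpen_annulus d (r i.castSucc) (r i.succ)
      have hFi : ContDiffOn ℝ 4 F (annulus d (r i.castSucc) (r i.succ)) :=
        hF.mono ((hsub i).trans hΩK)
      have h1 : laplacian (fun y ↦ F y - S y) =ᶠ[𝓝 x] fun y ↦ laplacian F y - laplacian S y := by
        filter_upwards [hΩi.mem_nhds hx] with y hy
        exact laplacian_sub ((hFi.contDiffAt (hΩi.mem_nhds hy)).of_le (by norm_num))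
          (((hS4 i).1.contDiffAt (hΩi.mem_nhds hy)).of_le (by norm_num))
      rw [laplacian_congr h1, laplacian_sub
        ((contDiffOn_laplacian hΩi hFi (by norm_num)).contDiffAt (hΩi.mem_nhds hx))
        ((contDiffOn_laplacian hΩi (hS4 i).1 (by norm_num)).contDiffAt (hΩi.mem_nhds hx)),
        (hS4 i).2 x hx, sub_zero, hGF (hsub i hx)])
  have hpoin := integral_sq_le_integral_laplacian_sq hd hn hr0 hr hE hE0
  have hi1 : IntegrableOn (fun x ↦ (F x - S x) ^ 2) Ω :=
    integrableOn_annulus (hE.continuousOn.pow 2) hΩK fun x _ ↦ rfl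
  have hi2 : IntegrableOn (fun x ↦ laplacian (laplacian F) x ^ 2) Ω :=
    integrableOn_annulus (hG.pow 2) hΩK fun x hx ↦ by simp [hGF hx]
  have hi3 : IntegrableOn (fun x ↦ (F x - S x) * laplacian (laplacian F) x) Ω :=
    integrableOn_annulus (hE.continuousOn.mul hG) hΩK fun x hx ↦ by simp [hGF hx]
  have hgreen' : ∫ x in Ω, laplacian (fun y ↦ F y - S y) x ^ 2 =
      ∫ x in Ω, (F x - S x) * laplacian (laplacian F) x :=
    hgreen.trans (setIntegral_congr_fun hΩo.measurableSet fun x hx ↦ by simp only [hGF hx])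
  rw [← hk, hgreen'] at hpoin
  have hk0 : 0 ≤ k := mul_nonneg (sq_nonneg _) (Real.iSup_nonneg fun i ↦ by positivity)
  have hsq : ∫ x in Ω, (F x - S x) ^ 2 ≤ k ^ 2 * ∫ x in Ω, laplacian (laplacian F) x ^ 2 := by
    have := integral_sq_le_of_poincare (μ := volume.restrict Ω) (k := -k) hi1 hi2 hi3
      (by linarith)
    rwa [neg_sq] at this
  calc Real.sqrt (∫ x in Ω, (F x - S x) ^ 2)
      ≤ Real.sqrt (k ^ 2 * ∫ x in Ω, laplacian (laplacian F) x ^ 2) := Real.sqrt_le_sqrt hsq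
    _ = k * Real.sqrt (∫ x in Ω, laplacian (laplacian F) x ^ 2) := by
        rw [Real.sqrt_mul (sq_nonneg k), Real.sqrt_sq hk0]
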